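/- arXiv:1904.10686 — 3 statements merged into one kernel-verified Lean document; each statement's English description precedes it below -/
import Mathlib

section
/- Under the standing hypotheses: (i) D is finite-dimensional as a K₀-vector space; (ii) for every g ∈ G and every nonzero x ∈ D_g, conjugation l ↦ x l x⁻¹ maps L onto L, is a field automorphism of L, and is independent of the choice of nonzero x ∈ D_g, yielding a group homomorphism ρ : G → Aut(L) with kernel H; (iii) the fixed field of ρ(G) in L equals K₀; and (iv) L/K₀ is a Galois extension with Galois group isomorphic to G/H. -/
variable {G : Type*} [Group G] [DecidableEq G] {D : Type*} [DivisionRing D]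

/-- A faithful `G`-grading on `D`: a family of additive subgroups forming an internal
direct sum decomposition, multiplicative, with all components nonzero. -/
structure IsFaithfulGrading (𝒜 : G → AddSubgroup D) : Prop where
  one_mem : (1 : D) ∈ 𝒜 1
  mul_mem : ∀ {g h : G} {x y : D}, x ∈ 𝒜 g → y ∈ 𝒜 h → x * y ∈ 𝒜 (g * h)
  isInternal : DirectSum.IsInternal 𝒜
  faithful : ∀ g, 𝒜 g ≠ ⊥

/-- `L`, the center of the identity component `D_e`, as a set. -/
def Lset (𝒜 : G → AddSubgroup D) : Set D := {x | x ∈ 𝒜 1 ∧ ∀ y ∈ 𝒜 1, x * y = y * x}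

/-- The kernel of the conjugation action of `G` on `L`, as a set:
`{g ∈ G : x·l = l·x for every x ∈ D_g and every l ∈ L}`. -/
def Hset (𝒜 : G → AddSubgroup D) : Set G := {g | ∀ x ∈ 𝒜 g, ∀ l ∈ Lset 𝒜, x * l = l * x}

/-- The identity component `D_e` as a subring of `D`. -/
def De (𝒜 : G → AddSubgroup D) (hG : IsFaithfulGrading 𝒜) : Subring D where
  carrier := 𝒜 1
  zero_mem' := zero_mem _
  one_mem' := hG.one_mem
  add_mem' := fun ha hb => add_mem ha hb
  neg_mem' := fun ha => neg_mem ha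
  mul_mem' := fun ha hb => by simpa using hG.mul_mem ha hb

/-- `L`, the center of the identity component, as a subring of `D`. -/
def Lring (𝒜 : G → AddSubgroup D) (hG : IsFaithfulGrading 𝒜) : Subring D where
  carrier := Lset 𝒜
  zero_mem' := ⟨zero_mem _, fun y _ => by rw [zero_mul, mul_zero]⟩
  one_mem' := ⟨hG.one_mem, fun y _ => by rw [one_mul, mul_one]⟩
  add_mem' := fun ha hb => ⟨add_mem ha.1 hb.1, fun y hy => by
    rw [add_mul, mul_add, ha.2 y hy, hb.2 y hy]⟩
  neg_mem' := fun ha => ⟨neg_mem ha.1, fun y hy => by rw [neg_mul, mul_neg, ha.2 y hy]⟩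
  mul_mem' := fun {a b} ha hb => ⟨by simpa using hG.mul_mem ha.1 hb.1,
    fun y hy => by rw [mul_assoc, hb.2 y hy, ← mul_assoc, ha.2 y hy, mul_assoc]⟩

lemma Lring_le_De (𝒜 : G → AddSubgroup D) (hG : IsFaithfulGrading 𝒜) :
    Lring 𝒜 hG ≤ De 𝒜 hG := fun _ hx => hx.1

/-- `dim_L D_e`, the dimension of the identity component over its center `L`. -/
noncomputable def dimLDe (𝒜 : G → AddSubgroup D) (hG : IsFaithfulGrading 𝒜) : ℕ :=
  letI : Module ↥(Lring 𝒜 hG) ↥(De 𝒜 hG) :=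
    (Subring.inclusion (Lring_le_De 𝒜 hG)).toModule
  Module.finrank ↥(Lring 𝒜 hG) ↥(De 𝒜 hG)

theorem grading_induction {𝒜 : G → AddSubgroup D} (hG : IsFaithfulGrading 𝒜) {P : D → Prop}
    (h0 : P 0) (hh : ∀ g, ∀ x ∈ 𝒜 g, P x) (ha : ∀ x y, P x → P y → P (x + y)) (d : D) : P d := by
  obtain ⟨f, rfl⟩ := hG.isInternal.surjective d
  induction f using DirectSum.induction_on with
  | zero => simpa using h0
  | of i x => simpa using hh i x x.2
  | add x y hx hy => rw [map_add]; exact ha _ _ hx hy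

theorem grading_exists_ne {𝒜 : G → AddSubgroup D} (hG : IsFaithfulGrading 𝒜) (g : G) :
    ∃ x ∈ 𝒜 g, x ≠ 0 := by
  obtain ⟨x, hx⟩ := AddSubgroup.ne_bot_iff_exists_ne_zero.1 (hG.faithful g)
  exact ⟨x, x.2, by simpa using hx⟩

theorem grading_inv_mem {𝒜 : G → AddSubgroup D} (hG : IsFaithfulGrading 𝒜) {g : G} {x : D}
    (hx : x ∈ 𝒜 g) (h0 : x ≠ 0) : x⁻¹ ∈ 𝒜 g⁻¹ := by
  have key : ∀ d : D, ∃ u ∈ 𝒜 g⁻¹, x * d - x * u ∈ ⨆ (j) (_ : j ≠ (1 : G)), 𝒜 j := by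
    intro d
    induction d using grading_induction hG with
    | h0 => exact ⟨0, zero_mem _, by simp [zero_mem]⟩
    | hh h y hy =>
      by_cases hgh : h = g⁻¹
      · subst hgh
        exact ⟨y, hy, by simp [zero_mem]⟩
      · refine ⟨0, zero_mem _, ?_⟩
        have : g * h ≠ 1 := fun hc => hgh (eq_inv_of_mul_eq_one_right hc)
        have h2 := hG.mul_mem hx hy
        simpa using (le_iSup₂_of_le (f := fun j (_ : j ≠ (1 : G)) => 𝒜 j) (g * h) this le_rfl) h2
    | ha y z hy hz =>
      obtain ⟨u, hu, hu'⟩ := hy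
      obtain ⟨v, hv, hv'⟩ := hz
      refine ⟨u + v, add_mem hu hv, ?_⟩
      have := add_mem hu' hv'
      convert this using 1
      simp only [mul_add]; abel
  obtain ⟨u, hu, hu'⟩ := key x⁻¹
  have hind := hG.isInternal.addSubgroup_iSupIndep
  have h1 : x * x⁻¹ - x * u ∈ 𝒜 1 := by
    rw [mul_inv_cancel₀ h0]
    have := hG.mul_mem hx hu
    rw [mul_inv_cancel] at this
    exact sub_mem hG.one_mem this
  have h2 := (AddSubgroup.disjoint_def.1 (hind 1)) h1 hu'
  have h3 : x * x⁻¹ = x * u := sub_eq_zero.1 h2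
  rw [mul_left_cancel₀ h0 h3]
  exact hu

theorem grading_conj_mem {𝒜 : G → AddSubgroup D} (hG : IsFaithfulGrading 𝒜) {g : G} {x y : D}
    (hx : x ∈ 𝒜 g) (h0 : x ≠ 0) (hy : y ∈ 𝒜 1) : x * y * x⁻¹ ∈ 𝒜 1 := by
  have := hG.mul_mem (hG.mul_mem hx hy) (grading_inv_mem hG hx h0)
  simpa using this

theorem grading_conj_mem' {𝒜 : G → AddSubgroup D} (hG : IsFaithfulGrading 𝒜) {g : G} {x y : D}
    (hx : x ∈ 𝒜 g) (h0 : x ≠ 0) (hy : y ∈ 𝒜 1) : x⁻¹ * y * x ∈ 𝒜 1 := by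
  have := hG.mul_mem (hG.mul_mem (grading_inv_mem hG hx h0) hy) hx
  simpa using this

theorem Lset_conj {𝒜 : G → AddSubgroup D} (hG : IsFaithfulGrading 𝒜) {g : G} {x l : D}
    (hx : x ∈ 𝒜 g) (h0 : x ≠ 0) (hl : l ∈ Lset 𝒜) : x * l * x⁻¹ ∈ Lset 𝒜 := by
  refine ⟨grading_conj_mem hG hx h0 hl.1, fun y hy => ?_⟩
  have h := hl.2 _ (grading_conj_mem' hG hx h0 hy)
  calc x * l * x⁻¹ * y = x * (l * (x⁻¹ * y * x)) * x⁻¹ := by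
        simp only [mul_assoc, mul_inv_cancel₀ h0, mul_one]
    _ = y * (x * l * x⁻¹) := by
        rw [h]; simp only [mul_assoc, mul_inv_cancel_left₀ h0]

theorem Lset_conj' {𝒜 : G → AddSubgroup D} (hG : IsFaithfulGrading 𝒜) {g : G} {x l : D}
    (hx : x ∈ 𝒜 g) (h0 : x ≠ 0) (hl : l ∈ Lset 𝒜) : x⁻¹ * l * x ∈ Lset 𝒜 := by
  simpa using Lset_conj hG (grading_inv_mem hG hx h0) (inv_ne_zero h0) hl

theorem conj_indep {𝒜 : G → AddSubgroup D} (hG : IsFaithfulGrading 𝒜) {g : G} {x y l : D}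
    (hx : x ∈ 𝒜 g) (hy : y ∈ 𝒜 g) (hx0 : x ≠ 0) (hy0 : y ≠ 0) (hl : l ∈ Lset 𝒜) :
    x * l * x⁻¹ = y * l * y⁻¹ := by
  have h1 : y⁻¹ * x ∈ 𝒜 1 := by simpa using hG.mul_mem (grading_inv_mem hG hy hy0) hx
  have h := hl.2 _ h1
  have : x * l = y * l * (y⁻¹ * x) := by
    rw [mul_assoc y, h]; simp only [mul_assoc, mul_inv_cancel_left₀ hy0]
  rw [this]; simp only [mul_assoc, mul_inv_cancel₀ hx0, mul_one]

theorem mem_center_of_homog {𝒜 : G → AddSubgroup D} (hG : IsFaithfulGrading 𝒜) {c : D}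
    (h : ∀ g, ∀ x ∈ 𝒜 g, x ≠ 0 → x * c * x⁻¹ = c) : c ∈ Subring.center D := by
  rw [Subring.mem_center_iff]
  intro d
  induction d using grading_induction hG with
  | h0 => simp
  | hh g x hx =>
    by_cases h0 : x = 0
    · simp [h0]
    · have := h g x hx h0
      rwa [mul_inv_eq_iff_eq_mul₀ h0] at this
  | ha x y hx hy => rw [add_mul, mul_add, hx, hy]

theorem conj_of_center {c x : D} (hc : c ∈ Subring.center D) (h0 : x ≠ 0) : x * c * x⁻¹ = c := by
  rw [Subring.mem_center_iff.1 hc x, mul_assoc, mul_inv_cancel₀ h0, mul_one]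

/-- The identity component as a division subring. -/
def DeF (𝒜 : G → AddSubgroup D) (hG : IsFaithfulGrading 𝒜) : Subfield D where
  toSubring := De 𝒜 hG
  inv_mem' := fun x hx => by
    by_cases h0 : x = 0
    · subst h0; simpa using hx
    · have : x⁻¹ ∈ 𝒜 1⁻¹ := grading_inv_mem hG hx h0
      rw [inv_one] at this; exact this

theorem mem_DeF {𝒜 : G → AddSubgroup D} {hG : IsFaithfulGrading 𝒜} {x : D} :
    x ∈ DeF 𝒜 hG ↔ x ∈ 𝒜 1 := Iff.rfl

theorem finite_over_De [Finite G] (𝒜 : G → AddSubgroup D) (hG : IsFaithfulGrading 𝒜) :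
    Module.Finite (DeF 𝒜 hG) D := by
  choose x hx hx0 using grading_exists_ne hG
  refine ⟨(Submodule.fg_def).2 ⟨Set.range x, Set.finite_range x, ?_⟩⟩
  rw [eq_top_iff]
  rintro d -
  induction d using grading_induction hG with
  | h0 => exact zero_mem _
  | hh g y hy =>
    have h1 : y * (x g)⁻¹ ∈ 𝒜 1 := by
      simpa using hG.mul_mem hy (grading_inv_mem hG (hx g) (hx0 g))
    have h2 : y = (⟨_, mem_DeF.2 h1⟩ : DeF 𝒜 hG) • x g := by
      change y = y * (x g)⁻¹ * x g
      rw [inv_mul_cancel_right₀ (hx0 g)]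
    rw [h2]
    exact Submodule.smul_mem _ _ (Submodule.subset_span ⟨g, rfl⟩)
  | ha y z hy hz => exact add_mem hy hz

theorem finite_over_K0 [Finite G] (𝒜 : G → AddSubgroup D) (hG : IsFaithfulGrading 𝒜)
    [Module.Finite ↥(Subring.center D) D] :
    Module.Finite ↥(Subring.center D ⊓ Lring 𝒜 hG) D := by
  have := finite_over_De 𝒜 hG
  obtain ⟨b, hbK, -, hspan, hli⟩ := exists_linearIndepOn_id_extension
    (K := DeF 𝒜 hG) (V := D) (s := ∅) (t := (Subring.center D : Set D))
    (linearIndependent_empty _ _) (Set.empty_subset _)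
  have hbf : b.Finite := hli.linearIndependent.set_finite_of_isNoetherian
  -- `K` lies in the `K₀`-span of `b`
  have hK : ∀ k ∈ Subring.center D,
      k ∈ Submodule.span ↥(Subring.center D ⊓ Lring 𝒜 hG) b := by
    intro k hk
    lift b to Finset D using hbf
    obtain ⟨c, -, hc⟩ := Submodule.mem_span_finset.1 (hspan hk)
    have hcc : ∀ i ∈ b, (c i : D) ∈ Subring.center D := by
      intro i hi
      refine mem_center_of_homog hG fun g x hx h0 => ?_
      let c' : D → DeF 𝒜 hG := fun i =>
        ⟨x * c i * x⁻¹, mem_DeF.2 (grading_conj_mem hG hx h0 (c i).2)⟩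
      have h1 : ∑ i ∈ b, c' i • id i = ∑ i ∈ b, c i • id i := by
        have h2 : x * k * x⁻¹ = k := conj_of_center hk h0
        rw [← hc, Finset.mul_sum, Finset.sum_mul] at h2
        refine Eq.trans (Finset.sum_congr rfl fun j hj => ?_) h2
        change x * c j * x⁻¹ * j = x * (c j * j) * x⁻¹
        have h3 := Subring.mem_center_iff.1 (hbK hj) x⁻¹
        simp only [mul_assoc, h3]
      have := linearIndepOn_finset_iffₛ.1 hli _ _ h1 i hi
      exact congrArg Subtype.val this
    rw [← hc]
    refine Submodule.sum_mem _ fun i hi => ?_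
    have hmem : (c i : D) ∈ Subring.center D ⊓ Lring 𝒜 hG :=
      ⟨hcc i hi, (c i).2, fun y _ => (Subring.mem_center_iff.1 (hcc i hi) y).symm⟩
    exact Submodule.smul_mem _ (⟨_, hmem⟩ : ↥(Subring.center D ⊓ Lring 𝒜 hG))
      (Submodule.subset_span hi)
  obtain ⟨e, he⟩ := (Module.Finite.fg_top : (⊤ : Submodule ↥(Subring.center D) D).FG)
  refine ⟨(Submodule.fg_def).2 ⟨Set.image2 (· * ·) b (e : Set D),
    hbf.image2 _ e.finite_toSet, ?_⟩⟩
  rw [eq_top_iff]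
  rintro d -
  obtain ⟨c, -, hc⟩ := Submodule.mem_span_finset.1 (he ▸ Submodule.mem_top : d ∈ _)
  rw [← hc]
  refine Submodule.sum_mem _ fun j hj => ?_
  change (c j : D) * j ∈ _
  have h := hK _ (c j).2
  generalize (c j : D) = k at h ⊢
  induction h using Submodule.span_induction with
  | mem x hx => exact Submodule.subset_span ⟨x, hx, j, hj, rfl⟩
  | zero => rw [zero_mul]; exact zero_mem _
  | add x y _ _ hx hy => rw [add_mul]; exact add_mem hx hy
  | smul a x _ hx =>
    have : a • x * j = a • (x * j) := mul_assoc (a : D) x j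
    rw [this]; exact Submodule.smul_mem _ _ hx

/-- Conjugation by a nonzero homogeneous element as a ring automorphism of `L`. -/
def conjL (𝒜 : G → AddSubgroup D) (hG : IsFaithfulGrading 𝒜) {g : G} {x : D}
    (hx : x ∈ 𝒜 g) (h0 : x ≠ 0) : RingAut ↥(Lring 𝒜 hG) where
  toFun l := ⟨x * l * x⁻¹, Lset_conj hG hx h0 l.2⟩
  invFun l := ⟨x⁻¹ * l * x, Lset_conj' hG hx h0 l.2⟩
  left_inv l := Subtype.ext (by
    simp only [mul_assoc, inv_mul_cancel₀ h0, inv_mul_cancel_left₀ h0, mul_one])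
  right_inv l := Subtype.ext (by
    simp only [mul_assoc, mul_inv_cancel₀ h0, mul_inv_cancel_left₀ h0, mul_one])
  map_mul' l m := Subtype.ext (by
    simp only [Subring.coe_mul, mul_assoc, inv_mul_cancel_left₀ h0])
  map_add' l m := Subtype.ext (by simp only [Subring.coe_add, mul_add, add_mul])

theorem exists_rho (𝒜 : G → AddSubgroup D) (hG : IsFaithfulGrading 𝒜) :
    ∃ ρ : G →* RingAut ↥(Lring 𝒜 hG),
      (∀ g : G, ∀ x ∈ 𝒜 g, x ≠ 0 →
        ∀ l : ↥(Lring 𝒜 hG), (ρ g l : D) = x * (l : D) * x⁻¹) := by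
  choose x hx hx0 using grading_exists_ne hG
  have key : ∀ g (y : D), y ∈ 𝒜 g → y ≠ 0 → ∀ l : ↥(Lring 𝒜 hG),
      (conjL 𝒜 hG (hx g) (hx0 g) l : D) = y * l * y⁻¹ := fun g y hy hy0 l =>
    conj_indep hG (hx g) hy (hx0 g) hy0 l.2
  refine ⟨MonoidHom.mk' (fun g => conjL 𝒜 hG (hx g) (hx0 g)) ?_, key⟩
  intro g h
  refine RingEquiv.ext fun l => Subtype.ext ?_
  rw [key (g * h) (x g * x h) (hG.mul_mem (hx g) (hx h)) (mul_ne_zero (hx0 g) (hx0 h))]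
  change _ = x g * (x h * l * (x h)⁻¹) * (x g)⁻¹
  simp only [mul_inv_rev, mul_assoc]

/-- `L` is a field. -/
@[reducible] def LField (𝒜 : G → AddSubgroup D) (hG : IsFaithfulGrading 𝒜) :
    Field ↥(Lring 𝒜 hG) :=
  { (inferInstance : Ring ↥(Lring 𝒜 hG)) with
    mul_comm := fun a b => Subtype.ext (a.2.2 b b.2.1)
    inv := fun l => ⟨(l : D)⁻¹, (DeF 𝒜 hG).inv_mem (mem_DeF.2 l.2.1), fun y hy => by
      have : Commute (l : D) y := l.2.2 y hy
      exact this.inv_left₀⟩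
    exists_pair_ne := ⟨0, 1, fun h => zero_ne_one (congrArg Subtype.val h)⟩
    mul_inv_cancel := fun a ha => Subtype.ext
      (mul_inv_cancel₀ fun h => ha (Subtype.ext h))
    inv_zero := Subtype.ext inv_zero
    nnqsmul := _
    nnqsmul_def := fun _ _ => rfl
    qsmul := _
    qsmul_def := fun _ _ => rfl }

theorem artin_surj {G F : Type*} [Group G] [Finite G] [Field F] (ρ : G →* RingAut F)
    (σ : RingAut F) (h : ∀ l : F, (∀ g, ρ g l = l) → σ l = l) : ∃ g, ρ g = σ := by
  letI : MulSemiringAction G F := MulSemiringAction.compHom F ρ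
  obtain ⟨g, hg⟩ := FixedPoints.toAlgAut_surjective G F
    (AlgEquiv.ofRingEquiv (f := σ) (fun x => h x fun g => x.2 g))
  exact ⟨g, RingEquiv.ext fun l => DFunLike.congr_fun hg l⟩

/-- Under the standing hypotheses: (i) `D` is finite dimensional over
`K₀ = K ∩ L`; (ii) conjugation by nonzero homogeneous elements gives a well-defined
homomorphism `ρ : G →* Aut(L)` with kernel `H`; (iii) the fixed field of `ρ(G)` is
exactly `K₀`; (iv) `L/K₀` is Galois with Galois group isomorphic to `G/H`
(equivalently, by Artin's theorem: the fixed field of the image of `ρ` is `K₀` and the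
image of `ρ` is the full group of automorphisms of `L` fixing `K₀` pointwise). -/
theorem conjugation_action_and_galois_general
    [Finite G] [CharZero D]
    (𝒜 : G → AddSubgroup D) (hG : IsFaithfulGrading 𝒜)
    [Module.Finite ↥(Subring.center D) D]
    (ζ : D) (hζK : ζ ∈ Subring.center D) (hζe : ζ ∈ 𝒜 1)
    (hζ : orderOf ζ = Monoid.exponent G) :
    -- (i) `D` is finite dimensional over `K₀ = K ∩ L`
    Module.Finite ↥(Subring.center D ⊓ Lring 𝒜 hG) D ∧
    -- (ii) conjugation maps `L` onto `L`, independently of the chosen representative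
    (∀ g : G, ∀ x ∈ 𝒜 g, x ≠ 0 →
      (∀ l ∈ Lset 𝒜, x * l * x⁻¹ ∈ Lset 𝒜) ∧
      (∀ l' ∈ Lset 𝒜, ∃ l ∈ Lset 𝒜, x * l * x⁻¹ = l')) ∧
    (∀ g : G, ∀ x ∈ 𝒜 g, ∀ y ∈ 𝒜 g, x ≠ 0 → y ≠ 0 →
      ∀ l ∈ Lset 𝒜, x * l * x⁻¹ = y * l * y⁻¹) ∧
    -- there is `ρ : G →* Aut(L)` induced by conjugation, with kernel `H`, fixed field
    -- `K₀`, and image the full group of automorphisms of `L` fixing `K₀` pointwise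
    -- (so `L/K₀` is Galois with Galois group `G/H`)
    ∃ ρ : G →* RingAut ↥(Lring 𝒜 hG),
      (∀ g : G, ∀ x ∈ 𝒜 g, x ≠ 0 →
        ∀ l : ↥(Lring 𝒜 hG), (ρ g l : D) = x * (l : D) * x⁻¹) ∧
      (∀ g : G, g ∈ MonoidHom.ker ρ ↔ g ∈ Hset 𝒜) ∧
      (∀ l : ↥(Lring 𝒜 hG), (∀ g : G, ρ g l = l) ↔
        (l : D) ∈ Subring.center D ⊓ Lring 𝒜 hG) ∧
      (∀ σ : RingAut ↥(Lring 𝒜 hG),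
        (∃ g : G, ρ g = σ) ↔
          ∀ l : ↥(Lring 𝒜 hG), (l : D) ∈ Subring.center D ⊓ Lring 𝒜 hG → σ l = l) := by
  refine ⟨finite_over_K0 𝒜 hG, fun g x hx h0 => ⟨fun l hl => Lset_conj hG hx h0 hl,
    fun l hl => ⟨x⁻¹ * l * x, Lset_conj' hG hx h0 hl, ?_⟩⟩,
    fun g x hx y hy hx0 hy0 l hl => conj_indep hG hx hy hx0 hy0 hl, ?_⟩
  · simp only [mul_assoc, mul_inv_cancel₀ h0, mul_inv_cancel_left₀ h0, mul_one]
  obtain ⟨ρ, hρ⟩ := exists_rho 𝒜 hG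
  have hfix : ∀ l : ↥(Lring 𝒜 hG), (∀ g : G, ρ g l = l) ↔
        (l : D) ∈ Subring.center D ⊓ Lring 𝒜 hG := by
    intro l
    constructor
    · intro h
      refine ⟨mem_center_of_homog hG fun g x hx h0 => ?_, l.2⟩
      rw [← hρ g x hx h0, h g]
    · intro h g
      obtain ⟨x, hx, h0⟩ := grading_exists_ne hG g
      exact Subtype.ext ((hρ g x hx h0 l).trans (conj_of_center h.1 h0))
  refine ⟨ρ, hρ, fun g => ?_, hfix, fun σ => ⟨?_, fun h => ?_⟩⟩
  · rw [MonoidHom.mem_ker]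
    constructor
    · intro h x hx l hl
      by_cases h0 : x = 0
      · simp [h0]
      · have h1 := hρ g x hx h0 ⟨l, hl⟩
        rw [h] at h1
        exact ((mul_inv_eq_iff_eq_mul₀ h0).1 h1.symm)
    · intro h
      obtain ⟨x, hx, h0⟩ := grading_exists_ne hG g
      refine RingEquiv.ext fun l => Subtype.ext ?_
      rw [hρ g x hx h0, h x hx l l.2, mul_inv_cancel_right₀ h0]
      rfl
  · rintro ⟨g, rfl⟩ l hl
    exact (hfix l).2 hl g
  · letI := LField 𝒜 hG
    exact artin_surj ρ σ fun l hl => h l ((hfix l).1 hl)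
end

section
/- Under the standing hypotheses: S is a subgroup of H which is normal in G; the center Z(D_H) of D_H is graded by S, i.e., Z(D_H) = ⊕_{s ∈ S} (Z(D_H) ∩ D_s), and each Z(D_H) ∩ D_s is a one-dimensional left L-vector space; and there exists a finite abelian group A such that H/S is isomorphic to A × A. -/
variable {G : Type*} [Group G] [DecidableEq G] {D : Type*} [DivisionRing D]

/-- `D_N`, the sum `⊕_{n ∈ N} D_n` of the homogeneous components over a subset `N` of
`G`, as an additive subgroup of `D`. -/
def DN (𝒜 : G → AddSubgroup D) (N : Set G) : AddSubgroup D := ⨆ g : N, 𝒜 (g : G)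

/-- The center `Z(D_N)` of `D_N`, as a set. -/
def ZDN (𝒜 : G → AddSubgroup D) (N : Set G) : Set D :=
  {x | x ∈ DN 𝒜 N ∧ ∀ y ∈ DN 𝒜 N, x * y = y * x}

/-- The set `S = {h ∈ H : D_h ∩ Z(D_H) ≠ {0}}`. -/
def Sset (𝒜 : G → AddSubgroup D) (N : Set G) : Set G :=
  {g | g ∈ N ∧ ∃ x : D, x ∈ 𝒜 g ∧ x ∈ ZDN 𝒜 N ∧ x ≠ 0}

/-- The center `Z(D_N)` of `D_N`, as an additive subgroup. -/
def ZDNadd (𝒜 : G → AddSubgroup D) (N : Set G) : AddSubgroup D where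
  carrier := ZDN 𝒜 N
  zero_mem' := ⟨zero_mem _, fun y _ => by rw [zero_mul, mul_zero]⟩
  add_mem' := fun ha hb => ⟨add_mem ha.1 hb.1, fun y hy => by
    rw [add_mul, mul_add, ha.2 y hy, hb.2 y hy]⟩
  neg_mem' := fun ha => ⟨neg_mem ha.1, fun y hy => by rw [neg_mul, mul_neg, ha.2 y hy]⟩


/-- Elementwise hypothesis: an element commuting with all its iterated conjugates by `k`
(pairwise) commutes with `k`. -/
def StarProp (H : Type*) [Group H] : Prop :=
  ∀ a k : H, (∀ i j : ℕ, Commute (k ^ i * a * (k ^ i)⁻¹) (k ^ j * a * (k ^ j)⁻¹)) → Commute k a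

theorem StarProp.subgroup {H : Type*} [Group H] (h : StarProp H) (U : Subgroup H) :
    StarProp U := by
  intro a k hc
  have := h a k (fun i j => by
    have := congrArg (Subtype.val) (hc i j).eq
    simpa [Commute, SemiconjBy] using this)
  exact Subtype.ext this.eq

theorem StarProp.normal_comm {H : Type*} [Group H] (h : StarProp H) (K : Subgroup H)
    (hn : K.Normal) (hK : ∀ a ∈ K, ∀ b ∈ K, Commute a b) : ∀ a ∈ K, ∀ k, Commute k a :=
  fun a ha k => h a k fun _ _ => hK _ (hn.conj_mem a ha _) _ (hn.conj_mem a ha _)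

theorem StarProp.nilpotent {H : Type*} [Group H] (h : StarProp H) [hN : Group.IsNilpotent H] :
    ∀ x y : H, Commute x y := by
  have key : ∀ n, Subgroup.upperCentralSeries H n ≤ Subgroup.center H := by
    intro n
    induction n with
    | zero => simp
    | succ n ih =>
      intro x hx
      rw [Subgroup.mem_upperCentralSeries_succ_iff] at hx
      rw [Subgroup.mem_center_iff]
      intro g
      refine (h x g fun i j => ?_).eq
      have hz : ∀ k : H, ∃ z ∈ Subgroup.center H, k * x * k⁻¹ = z * x := by
        intro k
        refine ⟨(x * k * x⁻¹ * k⁻¹)⁻¹, inv_mem (ih (hx k)), by group⟩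
      obtain ⟨z, hz1, hz2⟩ := hz (g ^ i)
      obtain ⟨w, hw1, hw2⟩ := hz (g ^ j)
      rw [hz2, hw2]
      rw [Subgroup.mem_center_iff] at hz1 hw1
      have a1 : Commute z (w * x) := (hz1 _).symm
      have a2 : Commute x (w * x) := (show Commute x w from hw1 x).mul_right (Commute.refl x)
      exact a1.mul_left a2
  obtain ⟨n, hn⟩ := hN
  intro x y
  have : x ∈ Subgroup.center H := key n (hn ▸ Subgroup.mem_top x)
  rw [Subgroup.mem_center_iff] at this
  exact (this y).symm

open scoped Pointwise in
theorem StarProp.comm_aux : ∀ (n : ℕ) (H : Type*) [Group H] [Finite H], Nat.card H = n →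
    StarProp H → ∀ x y : H, Commute x y := by
  intro n
  induction n using Nat.strong_induction_on with
  | _ n ih =>
  intro H _ _ hn h
  have hprop : ∀ U : Subgroup H, U ≠ ⊤ → ∀ a ∈ U, ∀ b ∈ U, Commute a b := by
    intro U hU a ha b hb
    have hlt : Nat.card U < n := by
      rw [← hn]
      refine lt_of_le_of_ne (Subgroup.card_le_card_group U) fun hh => hU ?_
      exact Subgroup.eq_top_of_card_eq U hh
    have := ih _ hlt U rfl (h.subgroup U) ⟨a, ha⟩ ⟨b, hb⟩
    exact congrArg Subtype.val this.eq
  by_cases hnil : Group.IsNilpotent H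
  · exact h.nilpotent
  · have := (Group.isNilpotent_of_finite_tfae (G := H)).out 0 3
    rw [this] at hnil
    push Not at hnil
    obtain ⟨p, hp, P, hP⟩ := hnil
    have hNt : Subgroup.normalizer ((P : Subgroup H) : Set H) ≠ ⊤ := by
      intro hh
      exact hP (Subgroup.normalizer_eq_top_iff.mp hh)
    have hNc := hprop _ hNt
    have hle : Subgroup.normalizer ((P : Subgroup H) : Set H) ≤ Subgroup.centralizer ((P : Subgroup H) : Set H) := by
      intro g hg
      rw [Subgroup.mem_centralizer_iff]
      intro q hq
      exact hNc q (Subgroup.le_normalizer hq) g hg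
    have hcompl := MonoidHom.ker_transferSylow_isComplement' P hle
    set K := (MonoidHom.transferSylow P hle).ker with hK
    have hKt : K ≠ ⊤ := by
      intro hh
      rw [hh] at hcompl
      have : (P : Subgroup H) = ⊥ := by
        have := hcompl.disjoint
        simpa using this
      apply hP
      rw [this]; infer_instance
    have hKc := h.normal_comm K inferInstance (hprop K hKt)
    have hPc : ∀ a ∈ P, ∀ b ∈ P, Commute a b := fun a ha b hb =>
      hNc a (Subgroup.le_normalizer ha) b (Subgroup.le_normalizer hb)
    intro x y
    have hx : x ∈ ((K : Set H) * (P : Set H)) := by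
      have h2 := Set.mem_univ x; rw [← hcompl.mul_eq] at h2; exact h2
    have hy : y ∈ ((K : Set H) * (P : Set H)) := by
      have h2 := Set.mem_univ y; rw [← hcompl.mul_eq] at h2; exact h2
    obtain ⟨a, ha, b, hb, rfl⟩ := hx
    obtain ⟨c, hc, d, hd, rfl⟩ := hy
    exact Commute.mul_left (hKc a ha _).symm
      (Commute.mul_right (hKc c hc b) (hPc b hb d hd))

theorem StarProp.comm {H : Type*} [Group H] [Finite H] (h : StarProp H) (x y : H) :
    Commute x y := StarProp.comm_aux _ H rfl h x y

/-- Independence lemma for division rings over their centers. -/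
theorem indep_aux {E : Type*} [DivisionRing E] {ι : Type*} [Fintype ι] (v : ι → E)
    (hv : LinearIndependent (Subring.center E) v) :
    ∀ (n : ℕ) (u : ι → E), (open Classical in (Finset.univ.filter (fun i => u i ≠ 0)).card = n) →
      (∀ b, ∑ i, u i * b * v i = 0) → u = 0 := by
  classical
  intro n
  induction n using Nat.strong_induction_on with
  | _ n ih =>
  intro u hn hu
  by_contra hne
  obtain ⟨i₀, hi₀⟩ := Function.ne_iff.mp hne
  simp only [Pi.zero_apply] at hi₀
  set w : ι → E := fun i => (u i₀)⁻¹ * u i with hw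
  have hw0 : w i₀ = 1 := inv_mul_cancel₀ hi₀
  have hwu : ∀ i, u i = 0 → w i = 0 := fun i hi => by simp [hw, hi]
  have hwb : ∀ b, ∑ i, w i * b * v i = 0 := by
    intro b
    have := congrArg (fun z => (u i₀)⁻¹ * z) (hu b)
    simpa [Finset.mul_sum, hw, mul_assoc] using this
  have hcen : ∀ a i, w i * a = a * w i := by
    intro a
    have h0 : (fun i => w i * a - a * w i) = 0 := by
      refine ih _ ?_ _ rfl ?_
      · rw [← hn]
        apply Finset.card_lt_card
        rw [Finset.ssubset_iff_of_subset]
        · exact ⟨i₀, by simpa using hi₀, by simp [hw0]⟩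
        · intro i
          simp only [Finset.mem_filter, Finset.mem_univ, true_and]
          intro h1 h2
          exact h1 (by rw [hwu i h2]; simp)
      · intro b
        have h1 := hwb (a * b)
        have h2 := congrArg (fun z => a * z) (hwb b)
        simp only [Finset.mul_sum, mul_zero] at h2
        calc ∑ i, (w i * a - a * w i) * b * v i
            = ∑ i, w i * (a * b) * v i - ∑ i, a * (w i * b * v i) := by
              rw [← Finset.sum_sub_distrib]
              refine Finset.sum_congr rfl fun i _ => ?_
              noncomm_ring
          _ = 0 := by rw [h1, h2, sub_zero]
    intro i
    exact sub_eq_zero.mp (congrFun h0 i)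
  have hmem : ∀ i, w i ∈ Subring.center E := fun i =>
    Subring.mem_center_iff.mpr fun a => (hcen a i).symm
  have h1 := Fintype.linearIndependent_iff.mp hv (fun i => ⟨w i, hmem i⟩) (by
    have := hwb 1
    simpa [Subring.smul_def] using this) i₀
  have h2 := congrArg Subtype.val h1
  simp [hw0] at h2

theorem skolem_noether_aux {E : Type*} [DivisionRing E] [Module.Finite (Subring.center E) E]
    (σ : E →+* E) (hσ : ∀ c ∈ Subring.center E, σ c = c) :
    ∃ u : E, u ≠ 0 ∧ ∀ a, u * a = σ a * u := by
  classical
  let F := Subring.center E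
  let b := Module.finBasis F E
  set m := Module.finrank F E with hm
  have hcm : ∀ (c : F) (x : E), (c : E) * x = x * c := fun c x =>
    (Subring.mem_center_iff.mp c.2 x).symm
  let Φ : (Fin m → E) →ₗ[F] (E →ₗ[F] E) :=
    { toFun := fun u =>
        { toFun := fun x => ∑ i, u i * x * b i
          map_add' := fun x y => by simp [mul_add, add_mul, Finset.sum_add_distrib]
          map_smul' := fun c x => by
            simp only [Subring.smul_def, smul_eq_mul, Finset.mul_sum, RingHom.id_apply]
            refine Finset.sum_congr rfl fun i _ => ?_
            rw [← mul_assoc (u i), ← hcm c (u i)]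
            simp only [mul_assoc] }
      map_add' := fun u w => by
        ext x
        simp [add_mul, Finset.sum_add_distrib]
      map_smul' := fun c u => by
        ext x
        simp [Subring.smul_def, Finset.mul_sum, mul_assoc] }
  have hinj : Function.Injective Φ := by
    rw [← LinearMap.ker_eq_bot, LinearMap.ker_eq_bot']
    intro u hu
    exact indep_aux b b.linearIndependent _ u rfl fun x => LinearMap.congr_fun hu x
  have hsurj : Function.Surjective Φ := by
    refine (LinearMap.injective_iff_surjective_of_finrank_eq_finrank ?_).mp hinj
    rw [Module.finrank_pi_fintype, Module.finrank_linearMap]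
    simp [hm, F]
  let τ : E →ₗ[F] E :=
    { toFun := σ
      map_add' := map_add σ
      map_smul' := fun c x => by simp [Subring.smul_def, hσ c c.2] }
  obtain ⟨u, hu⟩ := hsurj τ
  have hu' : ∀ x, ∑ i, u i * x * b i = σ x := fun x => LinearMap.congr_fun hu x
  have hne : u ≠ 0 := by
    rintro rfl
    have := hu' 1
    simp at this
  obtain ⟨i₀, hi₀⟩ := Function.ne_iff.mp hne
  refine ⟨u i₀, hi₀, fun a => ?_⟩
  have h0 : (fun i => u i * a - σ a * u i) = 0 := by
    refine indep_aux b b.linearIndependent _ _ rfl fun x => ?_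
    calc ∑ i, (u i * a - σ a * u i) * x * b i
        = ∑ i, u i * (a * x) * b i - σ a * ∑ i, u i * x * b i := by
          rw [Finset.mul_sum, ← Finset.sum_sub_distrib]
          refine Finset.sum_congr rfl fun i _ => ?_
          noncomm_ring
      _ = 0 := by rw [hu', hu', map_mul, sub_self]
  exact sub_eq_zero.mp (congrFun h0 i₀)

/-- A finite abelian group with a nondegenerate alternating pairing into the units of a field
is of the form `A × A`. -/
theorem symplectic_aux (K : Type*) [Field K] : ∀ (n : ℕ) (B : Type*) [CommGroup B] [Finite B],
    Nat.card B = n → ∀ c : B →* B →* Kˣ, (∀ x, c x x = 1) → (∀ x, (∀ y, c x y = 1) → x = 1) →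
    ∃ (A : Type) (_ : CommGroup A) (_ : Finite A), Nonempty (B ≃* A × A) := by
  intro n
  induction n using Nat.strong_induction_on with
  | _ n ih =>
  intro B _ _ hn c halt hnd
  have hskew : ∀ x y, c x y * c y x = 1 := by
    intro x y
    have := halt (x * y)
    simpa [halt] using this
  by_cases htriv : Subsingleton B
  · refine ⟨Unit, inferInstance, inferInstance, ⟨?_⟩⟩
    have : Unique B := ⟨⟨1⟩, fun a => Subsingleton.elim _ _⟩
    have : Unique (Unit × Unit) := ⟨⟨1⟩, fun a => Subsingleton.elim _ _⟩
    exact MulEquiv.ofUnique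
  rw [not_subsingleton_iff_nontrivial] at htriv
  obtain ⟨a, ha⟩ := Monoid.exists_orderOf_eq_exponent
    (Monoid.ExponentExists.of_finite (G := B))
  set N := Monoid.exponent B with hN
  have hNpos : 0 < N := Nat.pos_of_ne_zero Monoid.exponent_ne_zero_of_finite
  have : NeZero N := ⟨hNpos.ne'⟩
  have hpow : ∀ x y, (c x y) ^ N = 1 := by
    intro x y
    rw [← map_pow, Monoid.pow_exponent_eq_one, map_one]
  obtain ⟨b, hb⟩ : ∃ b, orderOf (c a b) = N := by
    have hfin : Finite (c a).range := Finite.of_surjective _ (c a).rangeRestrict_surjective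
    obtain ⟨⟨w, b, hbw⟩, hg⟩ := IsCyclic.exists_generator (α := (c a).range)
    refine ⟨b, Nat.dvd_antisymm (orderOf_dvd_of_pow_eq_one (hpow a b)) ?_⟩
    rw [← ha]
    apply orderOf_dvd_of_pow_eq_one
    apply hnd
    intro y
    rw [map_pow, MonoidHom.pow_apply]
    obtain ⟨k, hk⟩ := hg ⟨c a y, y, rfl⟩
    have hk' : w ^ k = c a y := congrArg Subtype.val hk
    rw [← hk', ← hbw, ← zpow_natCast, ← zpow_mul, mul_comm, zpow_mul, zpow_natCast,
      pow_orderOf_eq_one, one_zpow]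
  have hbN : b ^ N = 1 := Monoid.pow_exponent_eq_one b
  have haN : a ^ N = 1 := Monoid.pow_exponent_eq_one a
  set w := c a b with hw
  have hba : c b a = w⁻¹ := by
    rw [eq_inv_iff_mul_eq_one]; exact hskew b a
  have hprim : IsPrimitiveRoot (w : K) N := by
    rw [IsPrimitiveRoot.coe_units_iff, ← hb]; exact IsPrimitiveRoot.orderOf w
  have hlog : ∀ z : Kˣ, z ^ N = 1 → ∃ i : ℕ, w ^ i = z := by
    intro z hz
    obtain ⟨i, _, hi⟩ := hprim.eq_pow_of_pow_eq_one (ξ := (z : K)) (by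
      rw [← Units.val_pow_eq_pow_val, hz, Units.val_one])
    exact ⟨i, Units.ext (by simpa using hi)⟩
  let W : Subgroup B := (c a).ker ⊓ (c b).ker
  have hW1 : ∀ x ∈ W, c a x = 1 := fun x hx => hx.1
  have hW2 : ∀ x ∈ W, c b x = 1 := fun x hx => hx.2
  have hW1' : ∀ x ∈ W, c x a = 1 := fun x hx => by simpa [hW1 x hx] using hskew x a
  have hW2' : ∀ x ∈ W, c x b = 1 := fun x hx => by simpa [hW2 x hx] using hskew x b
  have hdec : ∀ x : B, ∃ i j : ℕ, ∃ y ∈ W, x = a ^ i * b ^ j * y := by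
    intro x
    obtain ⟨j, hj⟩ := hlog _ (hpow a x)
    obtain ⟨i, hi⟩ := hlog (c b x)⁻¹ (by rw [inv_pow, hpow, inv_one])
    refine ⟨i, j, (a ^ i * b ^ j)⁻¹ * x, ⟨?_, ?_⟩, by group⟩
    · change _ ∈ (c _).ker
      rw [MonoidHom.mem_ker]
      simp only [map_mul, map_inv, map_pow, halt, ← hw, ← hj]
      simp
    · change _ ∈ (c _).ker
      rw [MonoidHom.mem_ker]
      have : c b x = (w ^ i)⁻¹ := by rw [hi, inv_inv]
      simp only [map_mul, map_inv, map_pow, halt, hba, this]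
      simp
  let cW : W →* W →* Kˣ :=
    { toFun := fun x => (c x).comp W.subtype
      map_one' := by ext; simp
      map_mul' := fun x y => by ext; simp }
  have hWlt : Nat.card W < n := by
    rw [← hn]
    refine lt_of_le_of_ne (Subgroup.card_le_card_group W) fun hh => ?_
    have hWt := Subgroup.eq_top_of_card_eq W hh
    have hall : a = 1 := hnd a fun y => hW1 y (hWt ▸ Subgroup.mem_top y)
    rw [hall, orderOf_one] at ha
    have : ∀ x : B, x = 1 := fun x => by
      have := Monoid.pow_exponent_eq_one x
      rwa [← hN, ← ha, pow_one] at this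
    obtain ⟨x, y, hxy⟩ := htriv
    exact hxy ((this x).trans (this y).symm)
  obtain ⟨A, iA, fA, ⟨e⟩⟩ := ih _ hWlt W rfl cW (fun x => halt x) (by
    intro x hx
    apply Subtype.ext
    apply hnd
    intro y
    obtain ⟨i, j, y', hy', rfl⟩ := hdec y
    have := hx ⟨y', hy'⟩
    have h3 : c x y' = 1 := this
    simp [hW1' x x.2, hW2' x x.2, h3])
  -- the map from the product
  let f : Multiplicative (ZMod N) →* B := AddMonoidHom.toMultiplicativeLeft
    (ZMod.lift N ⟨(zmultiplesHom (Additive B)) (Additive.ofMul a), by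
      simp [← ofMul_pow, haN]⟩)
  let g : Multiplicative (ZMod N) →* B := AddMonoidHom.toMultiplicativeLeft
    (ZMod.lift N ⟨(zmultiplesHom (Additive B)) (Additive.ofMul b), by
      simp [← ofMul_pow, hbN]⟩)
  have hf : ∀ i : ℕ, f (Multiplicative.ofAdd (i : ZMod N)) = a ^ i := by
    intro i
    have := ZMod.lift_coe N ⟨(zmultiplesHom (Additive B)) (Additive.ofMul a), by
      simp [← ofMul_pow, haN]⟩ (i : ℤ)
    simp only [Int.cast_natCast] at this
    change Additive.toMul _ = _
    simp [this]
  have hg : ∀ i : ℕ, g (Multiplicative.ofAdd (i : ZMod N)) = b ^ i := by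
    intro i
    have := ZMod.lift_coe N ⟨(zmultiplesHom (Additive B)) (Additive.ofMul b), by
      simp [← ofMul_pow, hbN]⟩ (i : ℤ)
    simp only [Int.cast_natCast] at this
    change Additive.toMul _ = _
    simp [this]
  let Ψ : (Multiplicative (ZMod N) × Multiplicative (ZMod N)) × W →* B :=
    (f.coprod g).coprod W.subtype
  have hrep : ∀ z : Multiplicative (ZMod N), ∃ i : ℕ, i < N ∧
      z = Multiplicative.ofAdd (i : ZMod N) := fun z =>
    ⟨(Multiplicative.toAdd z).val, ZMod.val_lt _, by simp⟩
  have hsmall : ∀ i : ℕ, i < N → w ^ i = 1 → i = 0 := by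
    intro i hi h1
    have := orderOf_dvd_of_pow_eq_one h1
    rw [hb] at this
    exact Nat.eq_zero_of_dvd_of_lt this hi
  have hΨ : Function.Bijective Ψ := by
    constructor
    · rw [injective_iff_map_eq_one]
      rintro ⟨⟨z1, z2⟩, y⟩ hz
      obtain ⟨i, hi, rfl⟩ := hrep z1
      obtain ⟨j, hj, rfl⟩ := hrep z2
      have hz' : a ^ i * b ^ j * (y : B) = 1 := by
        rw [← hf, ← hg]; simpa [Ψ] using hz
      have e1 := congrArg (c a) hz'
      have e2 := congrArg (c b) hz'
      simp only [map_mul, map_pow, halt, ← hw, hW1 y y.2, hW2 y y.2, map_one, one_pow, one_mul,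
        mul_one, hba, inv_pow, inv_eq_one] at e1 e2
      obtain rfl := hsmall j hj e1
      obtain rfl := hsmall i hi e2
      have : y = 1 := Subtype.ext (by simpa using hz')
      simp [this]
    · intro x
      obtain ⟨i, j, y, hy, rfl⟩ := hdec x
      refine ⟨((Multiplicative.ofAdd (i : ZMod N), Multiplicative.ofAdd (j : ZMod N)), ⟨y, hy⟩), ?_⟩
      simp [Ψ, hf, hg]
  refine ⟨Multiplicative (ZMod N) × A, inferInstance, inferInstance, ⟨?_⟩⟩
  exact (MulEquiv.ofBijective Ψ hΨ).symm.trans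
    (((MulEquiv.refl _).prodCongr e).trans (MulEquiv.prodProdProdComm _ _ _ _))

section graded

theorem IsFaithfulGrading.exists_proj {𝒜 : G → AddSubgroup D} (hG : IsFaithfulGrading 𝒜)
    [Fintype G] : ∃ π : G → D →+ D, (∀ g x, π g x ∈ 𝒜 g) ∧ (∀ g x, x ∈ 𝒜 g → π g x = x) ∧
      (∀ g h x, x ∈ 𝒜 g → h ≠ g → π h x = 0) ∧ (∀ x, ∑ g, π g x = x) := by
  classical
  let _ := hG.isInternal.chooseDecomposition
  refine ⟨fun g => ((𝒜 g).subtype.comp (DFinsupp.evalAddMonoidHom g)).comp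
    (DirectSum.decomposeAddEquiv 𝒜).toAddMonoidHom, ?_, ?_, ?_, ?_⟩
  · intro g x
    exact (DirectSum.decompose 𝒜 x g).2
  · intro g x hx
    change ((DirectSum.decompose 𝒜 x g : 𝒜 g) : D) = x
    exact DirectSum.decompose_of_mem_same 𝒜 hx
  · intro g h x hx hne
    change ((DirectSum.decompose 𝒜 x h : 𝒜 h) : D) = 0
    exact DirectSum.decompose_of_mem_ne 𝒜 hx hne.symm
  · intro x
    change ∑ g, ((DirectSum.decompose 𝒜 x g : 𝒜 g) : D) = x
    conv_rhs => rw [← DirectSum.sum_support_decompose 𝒜 x]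
    symm
    apply Finset.sum_subset (Finset.subset_univ _)
    intro g _ hg
    simpa using hg

variable {𝒜 : G → AddSubgroup D}

theorem IsFaithfulGrading.eq_of_mem (hG : IsFaithfulGrading 𝒜) [Finite G] {g h : G} {x : D}
    (hx : x ∈ 𝒜 g) (hy : x ∈ 𝒜 h) (h0 : x ≠ 0) : g = h := by
  have := Fintype.ofFinite G
  obtain ⟨π, h1, h2, h3, h4⟩ := hG.exists_proj
  by_contra hne
  exact h0 ((h2 h x hy).symm.trans (h3 g h x hx (Ne.symm hne)))

theorem IsFaithfulGrading.inv_mem (hG : IsFaithfulGrading 𝒜) [Finite G] {g : G} {x : D}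
    (hx : x ∈ 𝒜 g) : x⁻¹ ∈ 𝒜 g⁻¹ := by
  classical
  by_cases h0 : x = 0
  · simp [h0]
  have := Fintype.ofFinite G
  obtain ⟨π, h1, h2, h3, h4⟩ := hG.exists_proj
  have e1 : ∑ h, x * π h x⁻¹ = 1 := by rw [← Finset.mul_sum, h4, mul_inv_cancel₀ h0]
  have e2 := congrArg (π 1) e1
  rw [map_sum, h2 1 1 hG.one_mem, Finset.sum_eq_single g⁻¹] at e2
  · rw [h2 1 _ (by simpa using hG.mul_mem hx (h1 g⁻¹ x⁻¹))] at e2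
    rw [← eq_inv_of_mul_eq_one_right e2]
    exact h1 _ _
  · intro h _ hh
    refine h3 (g * h) 1 _ (hG.mul_mem hx (h1 _ _)) ?_
    intro hc
    exact hh (eq_inv_of_mul_eq_one_right hc.symm)
  · simp

theorem IsFaithfulGrading.pow_mem (hG : IsFaithfulGrading 𝒜) {g : G} {x : D}
    (hx : x ∈ 𝒜 g) (n : ℕ) : x ^ n ∈ 𝒜 (g ^ n) := by
  induction n with
  | zero => simpa using hG.one_mem
  | succ n ih => rw [pow_succ, pow_succ]; exact hG.mul_mem ih hx

/-- Nonzero homogeneous elements of degree `h` centralizing `D_e`. -/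
def PP (𝒜 : G → AddSubgroup D) (h : G) (x : D) : Prop :=
  x ∈ 𝒜 h ∧ x ≠ 0 ∧ ∀ a ∈ 𝒜 1, x * a = a * x

theorem PP.mul (hG : IsFaithfulGrading 𝒜) {g h : G} {x y : D} (hx : PP 𝒜 g x) (hy : PP 𝒜 h y) :
    PP 𝒜 (g * h) (x * y) :=
  ⟨hG.mul_mem hx.1 hy.1, mul_ne_zero hx.2.1 hy.2.1, fun a ha => by
    rw [mul_assoc, hy.2.2 a ha, ← mul_assoc, hx.2.2 a ha, mul_assoc]⟩

theorem PP.inv (hG : IsFaithfulGrading 𝒜) [Finite G] {g : G} {x : D} (hx : PP 𝒜 g x) :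
    PP 𝒜 g⁻¹ x⁻¹ :=
  ⟨hG.inv_mem hx.1, inv_ne_zero hx.2.1, fun a ha =>
    (Commute.inv_left₀ (show Commute x a from hx.2.2 a ha)).eq⟩

theorem PP.pow (hG : IsFaithfulGrading 𝒜) {g : G} {x : D} (hx : PP 𝒜 g x) (n : ℕ) :
    PP 𝒜 (g ^ n) (x ^ n) :=
  ⟨hG.pow_mem hx.1 n, pow_ne_zero _ hx.2.1, fun a ha =>
    ((show Commute x a from hx.2.2 a ha).pow_left n).eq⟩

theorem PP.comm_one {g : G} {x l : D} (hx : PP 𝒜 g x) (hl : PP 𝒜 1 l) : Commute x l :=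
  hx.2.2 l hl.1

theorem PP.deg_eq (hG : IsFaithfulGrading 𝒜) [Finite G] {g h : G} {x : D} (hx : PP 𝒜 g x)
    (hy : PP 𝒜 h x) : g = h := hG.eq_of_mem hx.1 hy.1 hx.2.1

theorem PP.neg {g : G} {x : D} (hx : PP 𝒜 g x) : PP 𝒜 g (-x) :=
  ⟨neg_mem hx.1, neg_ne_zero.mpr hx.2.1, fun a ha => by rw [neg_mul, mul_neg, hx.2.2 a ha]⟩

theorem PP.scalar (hG : IsFaithfulGrading 𝒜) [Finite G] {g : G} {x y : D} (hx : PP 𝒜 g x)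
    (hy : PP 𝒜 g y) : ∃ l, PP 𝒜 1 l ∧ x = l * y :=
  ⟨x * y⁻¹, by simpa using hx.mul hG (hy.inv hG), by rw [inv_mul_cancel_right₀ hy.2.1]⟩

/-- For commuting degrees, elements commute up to a scalar. -/
theorem PP.comm_scalar (hG : IsFaithfulGrading 𝒜) [Finite G] {g h : G} {x y : D} (hx : PP 𝒜 g x)
    (hy : PP 𝒜 h y) (hgh : Commute g h) : ∃ l, PP 𝒜 1 l ∧ x * y = l * (y * x) := by
  refine (hx.mul hG hy).scalar hG ?_
  rw [hgh.eq]; exact hy.mul hG hx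

theorem root_mem {ζ : D} (hζK : ζ ∈ Subring.center D) {e : ℕ} (he : 0 < e) (hζ : orderOf ζ = e)
    {t : D} (ht : t ^ e = 1) : ∃ i : ℕ, t = ζ ^ i := by
  classical
  let K := Subring.center D
  let z : K := ⟨ζ, hζK⟩
  have hz : IsPrimitiveRoot z e := by
    have h1 : orderOf z = e := by
      rw [← hζ]
      exact (orderOf_injective (K.subtype : K →* D) Subtype.val_injective z).symm
    rw [← h1]; exact IsPrimitiveRoot.orderOf z
  have hp := Polynomial.X_pow_sub_one_eq_prod he hz
  have h2 := congrArg (Polynomial.aeval (R := K) t) hp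
  simp only [map_sub, map_pow, Polynomial.aeval_X, map_one, ht, sub_self] at h2
  have h3 : ∃ r : K, t = r ∧ r ^ e = 1 := by
    rw [← Finset.prod_map_toList, map_list_prod] at h2
    have h4 := List.prod_eq_zero_iff.mp h2.symm
    simp only [List.map_map, List.mem_map, Finset.mem_toList, Function.comp] at h4
    obtain ⟨r, hr, hr2⟩ := h4
    refine ⟨r, ?_, (Polynomial.mem_nthRootsFinset he _).mp hr⟩
    simp only [map_sub, Polynomial.aeval_X, Polynomial.aeval_C] at hr2
    exact sub_eq_zero.mp hr2
  obtain ⟨r, hr, hr2⟩ := h3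
  have : NeZero e := ⟨he.ne'⟩
  obtain ⟨i, _, hi⟩ := hz.eq_pow_of_pow_eq_one hr2
  refine ⟨i, ?_⟩
  rw [hr, ← hi]; rfl

theorem pow_comm_mul {t x m : D} (hxt : x * t = m * (t * x)) (ht : Commute t m)
    (hx : Commute x m) (n : ℕ) : x ^ n * t = m ^ n * (t * x ^ n) := by
  induction n with
  | zero => simp
  | succ n ih =>
    calc x ^ (n + 1) * t = x ^ n * (x * t) := by rw [pow_succ, mul_assoc]
      _ = (x ^ n * m) * (t * x) := by rw [hxt, mul_assoc]
      _ = m * ((x ^ n * t) * x) := by rw [(hx.pow_left n).eq]; simp only [mul_assoc]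
      _ = m ^ (n + 1) * (t * x ^ (n + 1)) := by
        rw [ih, pow_succ' m, pow_succ x]; simp only [mul_assoc]

theorem mul_pow_scalar {t x m : D} (hxt : x * t = m * (t * x)) (ht : Commute t m)
    (hx : Commute x m) (n : ℕ) : (t * x) ^ n = m ^ (n * (n - 1) / 2) * (t ^ n * x ^ n) := by
  rw [← Finset.sum_range_id_mul_two n] 
  rw [Nat.mul_div_cancel _ (by norm_num)]
  induction n with
  | zero => simp
  | succ n ih =>
    rw [pow_succ, ih, Finset.sum_range_succ]
    calc m ^ (∑ i ∈ Finset.range n, i) * (t ^ n * x ^ n) * (t * x)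
        = m ^ (∑ i ∈ Finset.range n, i) * (t ^ n * (x ^ n * t * x)) := by simp only [mul_assoc]
      _ = m ^ (∑ i ∈ Finset.range n, i) * ((t ^ n * m ^ n) * (t * x ^ n * x)) := by
        rw [pow_comm_mul hxt ht hx]; simp only [mul_assoc]
      _ = _ := by
        rw [((ht.pow_left n).pow_right n).eq, pow_add, pow_succ t, pow_succ x]
        simp only [mul_assoc]

theorem PP.commutator (hG : IsFaithfulGrading 𝒜) [Finite G] {ζ : D}
    (hζK : ζ ∈ Subring.center D) (hζe : ζ ∈ 𝒜 1) {e : ℕ} (he : 0 < e) (hζ : orderOf ζ = e)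
    (hexp : ∀ g : G, g ^ e = 1) {a k : G} {x y : D} (hx : PP 𝒜 a x) (hy : PP 𝒜 k y)
    (hc : Commute a (k * a * k⁻¹)) :
    k * a * k⁻¹ * a⁻¹ = 1 ∨ (e % 4 = 2 ∧ (k * a * k⁻¹ * a⁻¹) ^ 2 = 1 ∧
      ∃ s, PP 𝒜 (k * a * k⁻¹ * a⁻¹) s ∧ s * s = -1) := by
  set τ := k * a * k⁻¹ * a⁻¹ with hτ
  obtain ⟨t, htdef⟩ : ∃ t, t = y * x * y⁻¹ * x⁻¹ := ⟨_, rfl⟩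
  have hζ0 : ζ ≠ 0 := by
    rintro rfl
    rw [orderOf_eq_zero] at hζ
    · omega
    · rw [isOfFinOrder_iff_pow_eq_one]; rintro ⟨n, hn, h⟩; simp [hn.ne'] at h
  have hζP : PP 𝒜 1 ζ := ⟨hζe, hζ0, fun b _ => (Subring.mem_center_iff.mp hζK b).symm⟩
  have hroot : ∀ {g : G} {r : D}, PP 𝒜 g r → r ^ e = 1 → g = 1 ∧ ∀ b, Commute r b := by
    intro g r hr h1
    obtain ⟨i, rfl⟩ := root_mem hζK he hζ h1
    have h2 : PP 𝒜 1 (ζ ^ i) := by simpa using hζP.pow hG i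
    exact ⟨hr.deg_eq hG h2, fun b =>
      (show Commute ζ b from (Subring.mem_center_iff.mp hζK b).symm).pow_left i⟩
  have ht : PP 𝒜 τ t := htdef ▸ ((hy.mul hG hx).mul hG (hy.inv hG)).mul hG (hx.inv hG)
  have hτa : Commute a τ := by
    exact hc.mul_right (Commute.inv_right (Commute.refl a))
  obtain ⟨m, hm, hxt⟩ := hx.comm_scalar hG ht hτa
  have hm1 : m ≠ 0 := hm.2.1
  have htm := ht.comm_one hm
  have hxm := hx.comm_one hm
  have hxe : PP 𝒜 1 (x ^ e) := by have := hx.pow hG e; rwa [hexp] at this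
  have htx : t * x = y * x * y⁻¹ := by rw [htdef, inv_mul_cancel_right₀ hx.2.1]
  have hE : (t * x) ^ e = x ^ e := by
    rw [htx]
    have h1 : (y * x * y⁻¹) ^ e = y * x ^ e * y⁻¹ := by
      generalize e = n
      induction n with
      | zero => simp [mul_inv_cancel₀ hy.2.1]
      | succ n ih =>
        rw [pow_succ, ih, pow_succ]
        simp only [mul_assoc, inv_mul_cancel_left₀ hy.2.1]
    rw [h1, (hy.comm_one hxe).eq, mul_inv_cancel_right₀ hy.2.1]
  have hme : m ^ e = 1 := by
    have h1 := pow_comm_mul hxt htm hxm e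
    rw [(ht.comm_one hxe).symm.eq] at h1
    have h2 : t * x ^ e ≠ 0 := mul_ne_zero ht.2.1 hxe.2.1
    exact (mul_eq_right₀ h2).mp h1.symm
  have hte : m ^ (e * (e - 1) / 2) * t ^ e = 1 := by
    have h1 := mul_pow_scalar hxt htm hxm e
    rw [hE, ← mul_assoc] at h1
    exact (mul_eq_right₀ hxe.2.1).mp h1.symm
  have ht2e : (t ^ 2) ^ e = 1 := by
    have h1 : t ^ e = (m ^ (e * (e - 1) / 2))⁻¹ := eq_inv_of_mul_eq_one_right hte
    rw [← pow_mul, mul_comm 2 e, pow_mul, h1, inv_pow, ← pow_mul, mul_comm _ 2,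
      Nat.mul_div_cancel' (even_iff_two_dvd.mp (Nat.even_mul_pred_self e)), pow_mul, hme, one_pow,
      inv_one]
  obtain ⟨hτ2, ht2⟩ := hroot (ht.pow hG 2) ht2e
  have hm2 : m ^ 2 = 1 := by
    have h1 : x * t ^ 2 = m ^ 2 * (t ^ 2 * x) := by
      calc x * t ^ 2 = (x * t) * t := by rw [pow_two, mul_assoc]
        _ = m * t * (x * t) := by
          conv_lhs => rw [hxt]
          simp only [mul_assoc]
        _ = m * (t * m) * (t * x) := by rw [hxt, mul_assoc, mul_assoc, mul_assoc]
        _ = _ := by rw [htm.eq, pow_two, pow_two]; simp only [mul_assoc]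
    rw [(ht2 x).symm.eq] at h1
    exact (mul_eq_right₀ (mul_ne_zero (pow_ne_zero 2 ht.2.1) hx.2.1)).mp h1.symm
  have hmm : m = 1 ∨ m = -1 := mul_self_eq_one_iff.mp (by rw [← pow_two, hm2])
  by_cases h1 : m ^ (e * (e - 1) / 2) = 1
  · rw [h1, one_mul] at hte
    exact Or.inl (hroot ht hte).1
  right
  have hm' : m = -1 := hmm.resolve_left (by rintro rfl; simp at h1)
  have hodd : ¬ Even (e * (e - 1) / 2) := by
    intro h2
    exact h1 (by rw [hm', h2.neg_one_pow])
  have heven : Even e := by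
    by_contra h2
    rw [Nat.not_even_iff_odd] at h2
    rw [hm', h2.neg_one_pow] at hme
    rw [hm', hme, one_pow] at h1
    exact h1 rfl
  have he4 : e % 4 = 2 := by
    obtain ⟨r, hr⟩ := heven
    rcases Nat.even_or_odd r with h3 | h3
    · exfalso
      apply hodd
      have : e * (e - 1) / 2 = r * (e - 1) := by
        rw [show e * (e - 1) = r * (e - 1) * 2 by rw [hr]; ring, Nat.mul_div_cancel _ (by norm_num)]
      rw [this]
      exact h3.mul_right _
    · obtain ⟨j, hj⟩ := h3
      omega
  refine ⟨he4, hτ2, t ^ (e / 2), ?_, ?_⟩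
  · have h3 := ht.pow hG (e / 2)
    have h4 : τ ^ (e / 2) = τ := by
      rw [show e / 2 = 2 * (e / 4) + 1 by omega, pow_succ, pow_mul, hτ2, one_pow, one_mul]
    rwa [h4] at h3
  · rw [← pow_add, show e / 2 + e / 2 = e by omega]
    rw [hm', (Nat.not_even_iff_odd.mp hodd).neg_one_pow, neg_one_mul] at hte
    rw [← hte, neg_neg]

end graded

section graded2
variable {𝒜 : G → AddSubgroup D}

theorem PP.anticomm (hG : IsFaithfulGrading 𝒜) [Finite G] {g h : G} {s r : D} (hs : PP 𝒜 g s)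
    (hr : PP 𝒜 h r) (hss : s * s = -1) (hrr : r * r = -1) (hgh : Commute g h) (hne : g ≠ h) :
    r * s = -(s * r) := by
  obtain ⟨l, hl, hlr⟩ := hr.comm_scalar hG hs hgh.symm
  have hl2 : l * l = 1 := by
    have h1 : r * r * s = l * l * (s * (r * r)) := by
      calc r * r * s = r * (r * s) := mul_assoc _ _ _
        _ = (r * l) * (s * r) := by rw [hlr, mul_assoc]
        _ = l * (r * s) * r := by rw [(hr.comm_one hl).eq]; simp only [mul_assoc]
        _ = _ := by rw [hlr]; simp only [mul_assoc]
    rw [hrr, mul_neg, mul_neg, neg_mul, one_mul, mul_one, neg_inj] at h1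
    exact (mul_eq_right₀ hs.2.1).mp h1.symm
  rcases mul_self_eq_one_iff.mp hl2 with rfl | rfl
  · exfalso
    rw [one_mul] at hlr
    have h1 : (s - r) * (s + r) = 0 := by
      rw [sub_mul, mul_add, mul_add, hss, hrr, hlr]; abel
    rcases mul_eq_zero.mp h1 with h2 | h2
    · rw [sub_eq_zero] at h2; subst h2; exact hne (hs.deg_eq hG hr)
    · rw [add_eq_zero_iff_eq_neg] at h2; subst h2; exact hne (hs.deg_eq hG hr.neg)
  · rw [hlr, neg_one_mul]

theorem PP.three (hG : IsFaithfulGrading 𝒜) [Finite G] {g h k : G} {s r q : D} (hs : PP 𝒜 g s)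
    (hr : PP 𝒜 h r) (hq : PP 𝒜 k q) (hss : s * s = -1) (hrr : r * r = -1) (hqq : q * q = -1)
    (hrs : r * s = -(s * r)) (hqs : q * s = -(s * q)) (hqr : q * r = -(r * q)) :
    g * h * k = 1 := by
  have h1 : (s * r * q) * (s * r * q) = 1 := by
    calc (s * r * q) * (s * r * q) = s * r * (q * s) * r * q := by simp only [mul_assoc]
      _ = - (s * (r * s) * (q * r) * q) := by rw [hqs]; noncomm_ring
      _ = - ((s * s) * (r * r) * (q * q)) := by rw [hrs, hqr]; noncomm_ring
      _ = 1 := by rw [hss, hrr, hqq]; simp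
  have h2 := (hs.mul hG hr).mul hG hq
  have hone : PP 𝒜 1 (1 : D) := ⟨hG.one_mem, one_ne_zero, fun a _ => by simp⟩
  rcases mul_self_eq_one_iff.mp h1 with h3 | h3
  · rw [h3] at h2; exact h2.deg_eq hG hone
  · rw [h3] at h2; exact h2.deg_eq hG hone.neg

theorem no_omega [CharZero D] {ω s r : D} (hω : ω ∈ Subring.center D) (hω1 : 1 + ω + ω ^ 2 = 0)
    (hss : s * s = -1) (hrr : r * r = -1) (hrs : r * s = -(s * r)) : False := by
  let w : Subring.center D := ⟨ω, hω⟩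
  have hw : 1 + w + w ^ 2 = 0 := Subtype.ext hω1
  obtain ⟨u, hu⟩ : ∃ u, u = s * r := ⟨_, rfl⟩
  rw [← hu] at hrs
  have hsu : s * u = -r := by rw [hu, ← mul_assoc, hss, neg_one_mul]
  have hur : u * r = -s := by rw [hu, mul_assoc, hrr, mul_neg_one]
  have hus : u * s = r := by rw [hu, mul_assoc, hrs, mul_neg, hsu, neg_neg]
  have hru : r * u = s := by rw [hu, ← mul_assoc, hrs, neg_mul, hur, neg_neg]
  have huu : u * u = -1 := by
    nth_rewrite 1 [hu]; rw [mul_assoc, hru, hss]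
  have hv : (s + w • r + w ^ 2 • u) * (s + w • r + w ^ 2 • u) = 0 := by
    have : (s + w • r + w ^ 2 • u) * (s + w • r + w ^ 2 • u)
        = (-(1 + w ^ 2 + w ^ 4)) • (1 : D) := by
      simp only [add_mul, mul_add, smul_mul_assoc, mul_smul_comm, hss, hrr, hrs, hsu, hur, hus,
        hru, huu, ← hu]
      module
    rw [this, show -(1 + w ^ 2 + w ^ 4) = 0 by linear_combination -(1 - w + w ^ 2) * hw, zero_smul]
  have hv0 := mul_self_eq_zero.mp hv
  have h1 : s * (s + w • r + w ^ 2 • u) + (s + w • r + w ^ 2 • u) * s = (-2 : ℤ) • (1 : D) := by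
    simp only [add_mul, mul_add, smul_mul_assoc, mul_smul_comm, hss, hrs, hsu, hus, ← hu]
    module
  rw [hv0] at h1
  simp at h1

/-- Degrees of nonzero homogeneous elements centralizing `D_e`. -/
def QQ (hG : IsFaithfulGrading 𝒜) [Finite G] : Subgroup G where
  carrier := {g | ∃ x, PP 𝒜 g x}
  one_mem' := ⟨1, hG.one_mem, one_ne_zero, fun a _ => by simp⟩
  mul_mem' := fun ⟨x, hx⟩ ⟨y, hy⟩ => ⟨x * y, hx.mul hG hy⟩
  inv_mem' := fun ⟨x, hx⟩ => ⟨x⁻¹, hx.inv hG⟩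

theorem group_sub {a k τ : G} {e : ℕ} (hexp : ∀ g : G, g ^ e = 1) (he : e % 4 = 2)
    (h1 : k * a * k⁻¹ = τ * a) (h2 : Commute k τ) (hτ : τ ^ 2 = 1) (hc : Commute τ a) :
    τ = 1 := by
  have hk2 : Commute (k ^ 2) a := by
    have h3 : k * a = τ * a * k := by rw [← h1]; group
    show k ^ 2 * a = a * k ^ 2
    calc k ^ 2 * a = k * (k * a) := by rw [pow_two, mul_assoc]
      _ = (k * τ) * a * k := by rw [h3]; simp only [mul_assoc]
      _ = τ * (k * a) * k := by rw [h2.eq]; simp only [mul_assoc]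
      _ = τ ^ 2 * a * k ^ 2 := by rw [h3, pow_two, pow_two]; simp only [mul_assoc]
      _ = a * k ^ 2 := by rw [hτ, one_mul]
  obtain ⟨q, hq⟩ : ∃ q, e / 2 = 2 * q + 1 := ⟨e / 4, by omega⟩
  obtain ⟨y, hy⟩ : ∃ y, y = k ^ (e / 2) := ⟨_, rfl⟩
  have hyy : y * y = 1 := by
    rw [hy, ← pow_add, show e / 2 + e / 2 = e by omega, hexp]
  have hya : y * a = τ * a * y := by
    rw [hy, hq, pow_succ, pow_mul, mul_assoc, show k * a = τ * a * k by rw [← h1]; group,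
      ← mul_assoc, ((h2.pow_left 2 |>.mul_right hk2).pow_left q).eq, mul_assoc]
  have h3 : (y * a) * (y * a) = τ * (a * a) := by
    calc (y * a) * (y * a) = τ * a * (y * y) * a := by nth_rewrite 1 [hya]; simp only [mul_assoc]
      _ = _ := by rw [hyy]; simp only [mul_assoc, one_mul]
  have h4 := hexp (y * a)
  rw [show e = 2 * (e / 2) by omega, pow_mul, pow_two, h3,
    (hc.mul_right hc).mul_pow, ← pow_two a, ← pow_mul, show 2 * (e / 2) = e by omega, hexp,
    mul_one, hq, pow_succ, pow_mul, hτ, one_pow, one_mul] at h4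
  exact h4

theorem star_aux (hG : IsFaithfulGrading 𝒜) [Finite G] [CharZero D] {ζ : D}
    (hζK : ζ ∈ Subring.center D) (hζe : ζ ∈ 𝒜 1) {e : ℕ} (he : 0 < e) (hζ : orderOf ζ = e)
    (hexp : ∀ g : G, g ^ e = 1) (A : Subgroup G) (hA : ∀ a ∈ A, ∀ b ∈ A, Commute a b)
    (hAQ : A ≤ QQ hG) {k : G} (hk : k ∈ QQ hG) (hkA : ∀ a ∈ A, k * a * k⁻¹ ∈ A) {a : G}
    (ha : a ∈ A) : Commute k a := by
  obtain ⟨y, hy⟩ := hk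
  have hN : ∀ b ∈ A, k * b * k⁻¹ * b⁻¹ = 1 ∨ (e % 4 = 2 ∧ (k * b * k⁻¹ * b⁻¹) ^ 2 = 1 ∧
      ∃ s, PP 𝒜 (k * b * k⁻¹ * b⁻¹) s ∧ s * s = -1) := by
    intro b hb
    obtain ⟨x, hx⟩ := hAQ hb
    exact PP.commutator hG hζK hζe he hζ hexp hx hy (hA _ hb _ (hkA b hb))
  have hcm : ∀ b, k * b * k⁻¹ * b⁻¹ = 1 ↔ Commute k b := by
    intro b
    rw [mul_inv_eq_one, mul_inv_eq_iff_eq_mul]; rfl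
  have hmem : ∀ b ∈ A, k * b * k⁻¹ * b⁻¹ ∈ A := fun b hb => mul_mem (hkA b hb) (inv_mem hb)
  by_contra hne
  rw [← hcm] at hne
  have he4 : e % 4 = 2 := ((hN a ha).resolve_left hne).1
  have step : ∀ b ∈ A, k * b * k⁻¹ * b⁻¹ ≠ 1 → ∃ τ ∈ A, τ ≠ 1 ∧ τ * τ = 1 ∧
      (∃ s, PP 𝒜 τ s ∧ s * s = -1) ∧ k * b * k⁻¹ = τ * b ∧ k * τ * k⁻¹ * τ⁻¹ ≠ 1 := by
    intro b hb hb1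
    obtain ⟨-, h2, h3⟩ := (hN b hb).resolve_left hb1
    refine ⟨_, hmem b hb, hb1, by rw [← pow_two, h2], h3, by group, fun h4 => hb1 ?_⟩
    exact group_sub hexp he4 (by group) ((hcm _).mp h4) h2 (hA _ (hmem b hb) _ hb)
  obtain ⟨τ, hτA, hτ1, hττ, ⟨s, hs, hss⟩, -, hτn⟩ := step a ha hne
  obtain ⟨μ, hμA, hμ1, hμμ, ⟨r, hr, hrr⟩, hkτ, hμn⟩ := step τ hτA hτn
  obtain ⟨ν, hνA, hν1, hνν, ⟨q, hq, hqq⟩, hkμ, hνn⟩ := step μ hμA hμn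
  have c1 : τ ≠ μ := by
    rintro rfl
    rw [hττ] at hkτ
    exact hτ1 (by simpa using hkτ)
  have c2 : μ ≠ ν := by
    rintro rfl
    rw [hμμ] at hkμ
    exact hμ1 (by simpa using hkμ)
  have c3 : τ ≠ ν := by
    rintro rfl
    rw [(hA _ hτA _ hμA).eq, ← hkτ] at hkμ
    exact c1 (by simpa using hkμ.symm)
  have a1 := hs.anticomm hG hr hss hrr (hA _ hτA _ hμA) c1
  have a2 := hr.anticomm hG hq hrr hqq (hA _ hμA _ hνA) c2
  have a3 := hs.anticomm hG hq hss hqq (hA _ hτA _ hνA) c3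
  have h3 := hs.three hG hr hq hss hrr hqq a1 a3 a2
  have hkμ' : k * μ * k⁻¹ = τ := by
    have h5 : μ * ν = τ⁻¹ := eq_inv_of_mul_eq_one_right (by rw [← mul_assoc]; exact h3)
    rw [hkμ, ← (hA _ hμA _ hνA).eq, h5]
    exact inv_eq_of_mul_eq_one_left hττ
  have hk3 : Commute (k ^ 3) τ := by
    have e1 : k * (μ * τ) * k⁻¹ = μ := by
      calc k * (μ * τ) * k⁻¹ = (k * μ * k⁻¹) * (k * τ * k⁻¹) := by group
        _ = μ := by rw [hkμ', hkτ, (hA _ hμA _ hτA).eq, ← mul_assoc, hττ, one_mul]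
    have e2 : k ^ 3 * τ * (k ^ 3)⁻¹ = τ := by
      calc k ^ 3 * τ * (k ^ 3)⁻¹ = k * (k * (k * τ * k⁻¹) * k⁻¹) * k⁻¹ := by
            simp only [pow_succ, pow_zero, one_mul, mul_inv_rev, mul_assoc]
        _ = τ := by rw [hkτ, e1, hkμ']
    exact mul_inv_eq_iff_eq_mul.mp e2
  have h3e : e % 3 = 0 := by
    by_contra hcon
    apply hτn
    rw [hcm]
    have hke := hexp k
    have h4 : ∃ j : ℕ, k = (k ^ 3) ^ j := by
      rcases (show e % 3 = 1 ∨ e % 3 = 2 by omega) with h5 | h5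
      · refine ⟨2 * (e / 3) + 1, ?_⟩
        rw [← pow_mul, show 3 * (2 * (e / 3) + 1) = e * 2 + 1 by omega, pow_succ, pow_mul, hke]
        simp
      · refine ⟨e / 3 + 1, ?_⟩
        rw [← pow_mul, show 3 * (e / 3 + 1) = e + 1 by omega, pow_succ, hke, one_mul]
    obtain ⟨j, hj⟩ := h4
    rw [hj]
    exact hk3.pow_left j
  have hω3 : (ζ ^ (e / 3)) ^ 3 = 1 := by
    rw [← pow_mul, show e / 3 * 3 = e by omega, ← hζ, pow_orderOf_eq_one]
  have hω1 : ζ ^ (e / 3) ≠ 1 := by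
    intro h5
    have := orderOf_dvd_of_pow_eq_one h5
    rw [hζ] at this
    have := Nat.le_of_dvd (by omega) this
    omega
  refine no_omega (pow_mem hζK (e / 3)) ?_ hss hrr a1
  have h6 : (ζ ^ (e / 3) - 1) * (1 + ζ ^ (e / 3) + (ζ ^ (e / 3)) ^ 2) = 0 := by
    have : (ζ ^ (e / 3) - 1) * (1 + ζ ^ (e / 3) + (ζ ^ (e / 3)) ^ 2) = (ζ ^ (e / 3)) ^ 3 - 1 := by
      noncomm_ring
    rw [this, hω3, sub_self]
  exact (mul_eq_zero.mp h6).resolve_left (sub_ne_zero.mpr hω1)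

theorem QQ_comm (hG : IsFaithfulGrading 𝒜) [Finite G] [CharZero D] {ζ : D}
    (hζK : ζ ∈ Subring.center D) (hζe : ζ ∈ 𝒜 1) (hζ : orderOf ζ = Monoid.exponent G) :
    ∀ g ∈ QQ hG, ∀ h ∈ QQ hG, Commute g h := by
  have hstar : StarProp (QQ hG) := by
    intro a k hc
    let A : Subgroup (QQ hG) := Subgroup.closure (Set.range fun i : ℕ => k ^ i * a * (k ^ i)⁻¹)
    have hAc : ∀ x ∈ A, ∀ y ∈ A, Commute x y := by
      intro x hx y hy
      refine Subgroup.closure_induction₂ (p := fun x y _ _ => Commute x y) ?_ ?_ ?_ ?_ ?_ ?_ ?_ hx hy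
      · rintro _ _ ⟨i, rfl⟩ ⟨j, rfl⟩; exact hc i j
      · intro x _; exact Commute.one_left x
      · intro x _; exact Commute.one_right x
      · intro x y z _ _ _ h1 h2; exact h1.mul_left h2
      · intro x y z _ _ _ h1 h2; exact h1.mul_right h2
      · intro x y _ _ h1; exact h1.inv_left
      · intro x y _ _ h1; exact h1.inv_right
    have hkA : ∀ x ∈ A, k * x * k⁻¹ ∈ A := by
      intro x hx
      refine Subgroup.closure_induction (p := fun x _ => k * x * k⁻¹ ∈ A) ?_ ?_ ?_ ?_ hx
      · rintro _ ⟨i, rfl⟩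
        refine Subgroup.subset_closure ⟨i + 1, ?_⟩
        simp only [pow_succ', mul_inv_rev, mul_assoc]
      · simp
      · intro x y _ _ h1 h2
        have : k * (x * y) * k⁻¹ = (k * x * k⁻¹) * (k * y * k⁻¹) := by group
        rw [this]; exact mul_mem h1 h2
      · intro x _ h1
        have : k * x⁻¹ * k⁻¹ = (k * x * k⁻¹)⁻¹ := by group
        rw [this]; exact inv_mem h1
    have haA : a ∈ A := Subgroup.subset_closure ⟨0, by simp⟩
    have key := star_aux hG hζK hζe (Nat.pos_of_ne_zero Monoid.exponent_ne_zero_of_finite) hζ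
      (fun g => Monoid.pow_exponent_eq_one g) (A.map (QQ hG).subtype)
      (by
        rintro _ ⟨x, hx, rfl⟩ _ ⟨y, hy, rfl⟩
        exact congrArg Subtype.val (hAc x hx y hy).eq)
      (by rintro _ ⟨x, hx, rfl⟩; exact x.2) k.2
      (by rintro _ ⟨x, hx, rfl⟩; exact ⟨_, hkA x hx, rfl⟩) (a := (a : G)) ⟨a, haA, rfl⟩
    exact Subtype.ext key.eq
  intro g hg h hh
  exact congrArg Subtype.val (hstar.comm ⟨g, hg⟩ ⟨h, hh⟩).eq

end graded2

section final
variable {𝒜 : G → AddSubgroup D}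

/-- The identity component as a division subring. -/
def EE (hG : IsFaithfulGrading 𝒜) [Finite G] : Subfield D where
  carrier := 𝒜 1
  one_mem' := hG.one_mem
  mul_mem' := fun ha hb => by simpa using hG.mul_mem ha hb
  zero_mem' := zero_mem _
  add_mem' := fun ha hb => add_mem ha hb
  neg_mem' := fun ha => neg_mem ha
  inv_mem' := fun x hx => by
    have h := hG.inv_mem hx
    rw [inv_one] at h
    exact h

/-- A family of homogeneous projections. -/
def IsProj [Fintype G] (𝒜 : G → AddSubgroup D) (π : G → D →+ D) : Prop :=
  (∀ g x, π g x ∈ 𝒜 g) ∧ (∀ g x, x ∈ 𝒜 g → π g x = x) ∧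
      (∀ g h x, x ∈ 𝒜 g → h ≠ g → π h x = 0) ∧ (∀ x, ∑ g, π g x = x)

theorem IsProj.mul_right (hG : IsFaithfulGrading 𝒜) [Fintype G] {π : G → D →+ D}
    (hπ : IsProj 𝒜 π) {g h : G} {x v : D} (hv : v ∈ 𝒜 h) : π (g * h) (x * v) = π g x * v := by
  obtain ⟨h1, h2, h3, h4⟩ := hπ
  have e1 : x * v = ∑ k, π k x * v := by rw [← Finset.sum_mul, h4]
  rw [e1, map_sum, Finset.sum_eq_single g]
  · exact h2 _ _ (hG.mul_mem (h1 _ _) hv)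
  · intro k _ hk
    exact h3 (k * h) _ _ (hG.mul_mem (h1 _ _) hv) (fun hc => hk (mul_right_cancel hc).symm)
  · simp

theorem IsProj.mul_left (hG : IsFaithfulGrading 𝒜) [Fintype G] {π : G → D →+ D}
    (hπ : IsProj 𝒜 π) {g h : G} {x v : D} (hv : v ∈ 𝒜 h) : π (h * g) (v * x) = v * π g x := by
  obtain ⟨h1, h2, h3, h4⟩ := hπ
  have e1 : v * x = ∑ k, v * π k x := by rw [← Finset.mul_sum, h4]
  rw [e1, map_sum, Finset.sum_eq_single g]
  · exact h2 _ _ (hG.mul_mem hv (h1 _ _))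
  · intro k _ hk
    exact h3 (h * k) _ _ (hG.mul_mem hv (h1 _ _)) (fun hc => hk (mul_left_cancel hc).symm)
  · simp

theorem EE_finite (hG : IsFaithfulGrading 𝒜) [Finite G] [Module.Finite (Subring.center D) D] :
    Module.Finite (Subring.center (EE hG)) (EE hG) := by
  classical
  have := Fintype.ofFinite G
  obtain ⟨π, hπ'⟩ := hG.exists_proj
  have hπ : IsProj 𝒜 π := hπ'
  let b := Module.Basis.ofVectorSpace (Subring.center (EE hG)) (EE hG)
  have hli : LinearIndependent (Subring.center D) (fun i => ((b i : EE hG) : D)) := by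
    rw [linearIndependent_iff']
    intro s k hk i0 hi0
    by_contra hne
    have hk' : ∑ i ∈ s, (((k i0)⁻¹ * k i : Subring.center D) : D) * ((b i : EE hG) : D) = 0 := by
      have h1 := congrArg (fun z => (k i0)⁻¹ • z) hk
      simp only [Finset.smul_sum, smul_zero, smul_smul] at h1
      exact h1
    have hcen : ∀ z : Subring.center D, ∀ a ∈ 𝒜 1, π 1 (z : D) * a = a * π 1 (z : D) := by
      intro z a ha
      have h1 := hπ.mul_right hG (g := 1) (x := (z : D)) ha
      have h2 := hπ.mul_left hG (g := 1) (x := (z : D)) ha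
      rw [one_mul] at h1
      rw [mul_one] at h2
      rw [← h1, ← h2, Subring.mem_center_iff.mp z.2 a]
    let c : _ → Subring.center (EE hG) := fun i =>
      ⟨⟨π 1 (((k i0)⁻¹ * k i : Subring.center D) : D), hπ.1 _ _⟩, by
        rw [Subring.mem_center_iff]
        rintro ⟨a, ha⟩
        exact Subtype.ext (hcen _ a ha).symm⟩
    have hsum : ∑ i ∈ s, c i • b i = 0 := by
      apply Subtype.ext
      have h1 := congrArg (π 1) hk'
      rw [map_sum, map_zero] at h1
      have h2 : ((∑ i ∈ s, c i • b i : EE hG) : D) = ∑ i ∈ s, ((c i • b i : EE hG) : D) := by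
        exact map_sum (EE hG).subtype _ _
      rw [h2]
      refine (Finset.sum_congr rfl ?_).trans h1
      intro i _
      have h3 := hπ.mul_right hG (g := 1) (x := (((k i0)⁻¹ * k i : Subring.center D) : D))
        (b i).2
      rw [one_mul] at h3
      exact h3.symm
    have h4 := linearIndependent_iff'.mp b.linearIndependent s c hsum i0 hi0
    have h5 : π 1 (((k i0)⁻¹ * k i0 : Subring.center D) : D) = 0 :=
      congrArg (fun z : Subring.center (EE hG) => ((z : EE hG) : D)) h4
    rw [inv_mul_cancel₀ hne] at h5
    have h6 := hπ.2.1 1 1 hG.one_mem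
    exact one_ne_zero (h6.symm.trans h5)
  have := hli.finite
  exact Module.Finite.of_basis b

theorem exists_PP (hG : IsFaithfulGrading 𝒜) [Finite G] [Module.Finite (Subring.center D) D]
    {h : G} (hh : h ∈ Hset 𝒜) : ∃ x, PP 𝒜 h x := by
  have := EE_finite hG
  obtain ⟨⟨x, hx⟩, hx1⟩ := AddSubgroup.ne_bot_iff_exists_ne_zero.mp (hG.faithful h)
  have hx0 : x ≠ 0 := fun hc => hx1 (Subtype.ext hc)
  have hmem : ∀ a ∈ 𝒜 1, x * a * x⁻¹ ∈ 𝒜 1 := by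
    intro a ha
    simpa using hG.mul_mem (hG.mul_mem hx ha) (hG.inv_mem hx)
  let σ : EE hG →+* EE hG :=
    { toFun := fun a => ⟨x * a * x⁻¹, hmem a a.2⟩
      map_one' := Subtype.ext (by simp [mul_inv_cancel₀ hx0])
      map_mul' := fun a b => Subtype.ext (by
        simp only [Subfield.coe_mul, MulMemClass.mk_mul_mk, mul_assoc, inv_mul_cancel_left₀ hx0])
      map_zero' := Subtype.ext (by simp)
      map_add' := fun a b => Subtype.ext (by simp [mul_add, add_mul]) }
  obtain ⟨u, hu0, hu⟩ := skolem_noether_aux σ (by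
    intro c hc
    apply Subtype.ext
    change x * (c : D) * x⁻¹ = c
    rw [hh x hx (c : D) ⟨c.2, fun y hy =>
      (congrArg Subtype.val (Subring.mem_center_iff.mp hc ⟨y, hy⟩)).symm⟩,
      mul_inv_cancel_right₀ hx0])
  have hu0' : (u : D) ≠ 0 := fun hc => hu0 (Subtype.ext hc)
  refine ⟨(u : D)⁻¹ * x, by simpa using hG.mul_mem (hG.inv_mem (show (u : D) ∈ 𝒜 1 from u.2)) hx,
    mul_ne_zero (inv_ne_zero hu0') hx0, ?_⟩
  intro a ha
  have h1 : (u : D) * a = x * a * x⁻¹ * u := congrArg Subtype.val (hu ⟨a, ha⟩)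
  have h2 : (u : D)⁻¹ * (x * a * x⁻¹) = a * (u : D)⁻¹ := by
    rw [eq_mul_inv_iff_mul_eq₀ hu0', mul_assoc, ← h1, inv_mul_cancel_left₀ hu0']
  calc (u : D)⁻¹ * x * a = (u : D)⁻¹ * (x * a * x⁻¹) * x := by
        simp only [mul_assoc, inv_mul_cancel₀ hx0, mul_one]
    _ = a * ((u : D)⁻¹ * x) := by rw [h2, mul_assoc]

theorem mem_DN {N : Set G} {g : G} (hg : g ∈ N) {x : D} (hx : x ∈ 𝒜 g) : x ∈ DN 𝒜 N :=
  AddSubgroup.mem_iSup_of_mem (⟨g, hg⟩ : N) hx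

theorem comm_DN {N : Set G} {x : D} (h : ∀ g ∈ N, ∀ y ∈ 𝒜 g, x * y = y * x) :
    ∀ y ∈ DN 𝒜 N, x * y = y * x := by
  intro y hy
  refine AddSubgroup.iSup_induction (fun g : N => 𝒜 (g : G))
    (C := fun y => x * y = y * x) hy ?_ ?_ ?_
  · intro i y hy; exact h i i.2 y hy
  · simp
  · intro a b ha hb; rw [mul_add, add_mul, ha, hb]

theorem proj_DN [Fintype G] {π : G → D →+ D} (hπ : IsProj 𝒜 π) {N : Set G} {x : D}
    (hx : x ∈ DN 𝒜 N) {g : G} (hg : g ∉ N) : π g x = 0 := by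
  refine AddSubgroup.iSup_induction (fun g : N => 𝒜 (g : G))
    (C := fun y => π g y = 0) hx ?_ ?_ ?_
  · intro i y hy; exact hπ.2.2.1 _ _ _ hy (fun hc => hg (hc ▸ i.2))
  · simp
  · intro a b ha hb; rw [map_add, ha, hb, add_zero]

theorem PP_mem_Z (hG : IsFaithfulGrading 𝒜) [Finite G] {N : Set G} {h : G} (hh : h ∈ N) {x : D}
    (hx : PP 𝒜 h x) (hc : ∀ k ∈ N, ∃ y, PP 𝒜 k y ∧ x * y = y * x) : x ∈ ZDN 𝒜 N := by
  refine ⟨mem_DN hh hx.1, comm_DN ?_⟩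
  intro k hk z hz
  obtain ⟨y, hy, hxy⟩ := hc k hk
  have h1 : z * y⁻¹ ∈ 𝒜 1 := by simpa using hG.mul_mem hz (hG.inv_mem hy.1)
  have h2 : Commute x (z * y⁻¹ * y) := (show Commute x _ from hx.2.2 _ h1).mul_right hxy
  rw [inv_mul_cancel_right₀ hy.2.1] at h2
  exact h2

/-- The pairing scalar. -/
theorem PP.pairing (hG : IsFaithfulGrading 𝒜) [Finite G] {ζ : D}
    (hζK : ζ ∈ Subring.center D) (hζ : orderOf ζ = Monoid.exponent G) {g h : G} {x y : D}
    (hx : PP 𝒜 g x) (hy : PP 𝒜 h y) (hgh : Commute g h) :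
    ∃ κ : (Subring.center D)ˣ, x * y = ((κ : Subring.center D) : D) * (y * x) := by
  obtain ⟨m, hm, hxy⟩ := hx.comm_scalar hG hy hgh
  have he : 0 < Monoid.exponent G := Nat.pos_of_ne_zero Monoid.exponent_ne_zero_of_finite
  have h1 := pow_comm_mul hxy (hy.comm_one hm) (hx.comm_one hm) (Monoid.exponent G)
  have hxe : PP 𝒜 1 (x ^ Monoid.exponent G) := by
    have := hx.pow hG (Monoid.exponent G)
    rwa [Monoid.pow_exponent_eq_one] at this
  rw [← (hy.comm_one hxe).eq] at h1
  have h2 : m ^ Monoid.exponent G = 1 :=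
    (mul_eq_right₀ (mul_ne_zero hy.2.1 hxe.2.1)).mp h1.symm
  obtain ⟨i, hi⟩ := root_mem hζK he hζ h2
  have hmK : m ∈ Subring.center D := hi ▸ pow_mem hζK i
  exact ⟨Units.mk0 ⟨m, hmK⟩ (fun hc => hm.2.1 (congrArg Subtype.val hc)), hxy⟩

end final
/-- Under the standing hypotheses: `S` is a subgroup of `H` normal in
`G`; the center `Z(D_H)` is graded by `S`, i.e. `Z(D_H) = ⊕_{s ∈ S} (Z(D_H) ∩ D_s)`
with each `Z(D_H) ∩ D_s` one-dimensional over `L`; and `H/S ≅ A × A` for some finite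
abelian group `A`. -/
theorem S_subgroup_center_graded_and_quotient_product
    [Finite G] [CharZero D]
    (𝒜 : G → AddSubgroup D) (hG : IsFaithfulGrading 𝒜)
    [Module.Finite ↥(Subring.center D) D]
    (ζ : D) (hζK : ζ ∈ Subring.center D) (hζe : ζ ∈ 𝒜 1)
    (hζ : orderOf ζ = Monoid.exponent G)
    (H : Subgroup G) (hHcar : (H : Set G) = Hset 𝒜) (hHn : H.Normal) :
    ∃ S : Subgroup G, (S : Set G) = Sset 𝒜 (H : Set G) ∧ S ≤ H ∧ S.Normal ∧
      -- `Z(D_H)` is graded by `S`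
      (∀ x : D, x ∈ ZDN 𝒜 (H : Set G) ↔
        x ∈ ⨆ s : Sset 𝒜 (H : Set G), (ZDNadd 𝒜 (H : Set G) ⊓ 𝒜 (s : G))) ∧
      -- each `Z(D_H) ∩ D_s` is a one-dimensional left `L`-vector space
      (∀ s ∈ Sset 𝒜 (H : Set G), ∃ x : D, x ≠ 0 ∧ x ∈ ZDNadd 𝒜 (H : Set G) ⊓ 𝒜 s ∧
        ∀ y ∈ ZDNadd 𝒜 (H : Set G) ⊓ 𝒜 s, ∃ l ∈ Lset 𝒜, y = l * x) ∧
      -- `H/S` is isomorphic to `A × A` for a finite abelian group `A`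
      ∃ (_ : (S.subgroupOf H).Normal) (A : Type) (_ : CommGroup A) (_ : Finite A),
        Nonempty ((↥H ⧸ S.subgroupOf H) ≃* A × A) := by
  classical
  have := Fintype.ofFinite G
  obtain ⟨π, hπ'⟩ := hG.exists_proj
  have hπ : IsProj 𝒜 π := hπ'
  have hPP : ∀ h ∈ H, ∃ x, PP 𝒜 h x := by
    intro h hh
    exact exists_PP hG (hHcar ▸ hh : h ∈ Hset 𝒜)
  have hab : ∀ g ∈ H, ∀ h ∈ H, Commute g h := fun g hg h hh =>
    QQ_comm hG hζK hζe hζ g (hPP g hg) h (hPP h hh)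
  have hone : (1 : G) ∈ (H : Set G) := one_mem H
  have hZPP : ∀ {s : G} {z : D}, z ∈ 𝒜 s → z ∈ ZDN 𝒜 (H : Set G) → z ≠ 0 → PP 𝒜 s z :=
    fun h1 h2 h3 => ⟨h1, h3, fun a ha => h2.2 a (mem_DN hone ha)⟩
  have hcomp : ∀ z ∈ ZDN 𝒜 (H : Set G), ∀ g, π g z ∈ ZDN 𝒜 (H : Set G) := by
    intro z hz g
    by_cases hg : g ∈ (H : Set G)
    · refine ⟨mem_DN hg (hπ.1 g z), comm_DN ?_⟩
      intro k hk y hy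
      rw [← hπ.mul_right hG hy, ← hπ.mul_left hG hy, hz.2 y (mem_DN hk hy), (hab g hg k hk).eq]
    · rw [proj_DN hπ hz.1 hg]
      exact (ZDNadd 𝒜 (H : Set G)).zero_mem
  have hDNmul : ∀ x ∈ ZDN 𝒜 (H : Set G), ∀ y ∈ DN 𝒜 (H : Set G), Commute x y :=
    fun x hx y hy => hx.2 y hy
  let S : Subgroup G :=
    { carrier := Sset 𝒜 (H : Set G)
      one_mem' := ⟨hone, 1, hG.one_mem, ⟨mem_DN hone hG.one_mem, fun y _ => by simp⟩, one_ne_zero⟩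
      mul_mem' := by
        rintro a b ⟨ha, x, hx1, hx2, hx3⟩ ⟨hb, y, hy1, hy2, hy3⟩
        have hab' : a * b ∈ (H : Set G) := H.mul_mem ha hb
        exact ⟨hab', x * y, hG.mul_mem hx1 hy1, ⟨mem_DN hab' (hG.mul_mem hx1 hy1), fun z hz =>
          ((hDNmul x hx2 z hz).mul_left (hDNmul y hy2 z hz)).eq⟩, mul_ne_zero hx3 hy3⟩
      inv_mem' := by
        rintro a ⟨ha, x, hx1, hx2, hx3⟩
        have ha' : a⁻¹ ∈ (H : Set G) := H.inv_mem ha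
        exact ⟨ha', x⁻¹, hG.inv_mem hx1, ⟨mem_DN ha' (hG.inv_mem hx1), fun z hz =>
          (Commute.inv_left₀ (hDNmul x hx2 z hz)).eq⟩, inv_ne_zero hx3⟩ }
  have hSH : S ≤ H := fun s hs => hs.1
  have hSn : S.Normal := by
    constructor
    rintro s ⟨hs, x, hx1, hx2, hx3⟩ g
    obtain ⟨⟨y, hy⟩, hy1⟩ := AddSubgroup.ne_bot_iff_exists_ne_zero.mp (hG.faithful g)
    have hy0 : y ≠ 0 := fun hc => hy1 (Subtype.ext hc)
    have hgs : g * s * g⁻¹ ∈ (H : Set G) := hHn.conj_mem s hs g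
    have hm : y * x * y⁻¹ ∈ 𝒜 (g * s * g⁻¹) := hG.mul_mem (hG.mul_mem hy hx1) (hG.inv_mem hy)
    refine ⟨hgs, y * x * y⁻¹, hm, ⟨mem_DN hgs hm, comm_DN ?_⟩,
      mul_ne_zero (mul_ne_zero hy0 hx3) (inv_ne_zero hy0)⟩
    intro k hk z hz
    have h1 : y⁻¹ * z * y ∈ 𝒜 (g⁻¹ * k * g) := hG.mul_mem (hG.mul_mem (hG.inv_mem hy) hz) hy
    have h2 : g⁻¹ * k * g ∈ (H : Set G) := by
      have := hHn.conj_mem k hk g⁻¹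
      rwa [inv_inv] at this
    have h3 := hx2.2 _ (mem_DN h2 h1)
    calc y * x * y⁻¹ * z = y * (x * (y⁻¹ * z * y)) * y⁻¹ := by
          simp only [mul_assoc, mul_inv_cancel₀ hy0, mul_one]
      _ = z * (y * x * y⁻¹) := by
          rw [h3]; simp only [mul_assoc, mul_inv_cancel_left₀ hy0]
  refine ⟨S, rfl, hSH, hSn, ?_, ?_, ?_⟩
  · intro x
    constructor
    · intro hx
      rw [← hπ.2.2.2 x]
      refine AddSubgroup.sum_mem _ fun g _ => ?_
      by_cases h0 : π g x = 0
      · rw [h0]; exact zero_mem _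
      · have hgH : g ∈ (H : Set G) := by
          by_contra hc
          exact h0 (proj_DN hπ hx.1 hc)
        exact AddSubgroup.mem_iSup_of_mem
          (⟨g, hgH, π g x, hπ.1 g x, hcomp x hx g, h0⟩ : Sset 𝒜 (H : Set G))
          ⟨hcomp x hx g, hπ.1 g x⟩
    · intro hx
      have h1 : (⨆ s : Sset 𝒜 (H : Set G), (ZDNadd 𝒜 (H : Set G) ⊓ 𝒜 (s : G)))
          ≤ ZDNadd 𝒜 (H : Set G) := iSup_le fun s => inf_le_left
      exact h1 hx
  · rintro s ⟨hs, x, hx1, hx2, hx3⟩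
    refine ⟨x, hx3, ⟨hx2, hx1⟩, ?_⟩
    rintro y ⟨hy1, hy2⟩
    by_cases h0 : y = 0
    · exact ⟨0, ⟨zero_mem _, fun z _ => by simp⟩, by simp [h0]⟩
    · obtain ⟨l, hl, hyl⟩ := (hZPP hy2 hy1 h0).scalar hG (hZPP hx1 hx2 hx3)
      exact ⟨l, ⟨hl.1, hl.2.2⟩, hyl⟩
  · have hN : (S.subgroupOf H).Normal := hSn.subgroupOf H
    refine ⟨hN, ?_⟩
    have hScomm : ∀ {s k : G} {z y : D}, s ∈ S → k ∈ H → PP 𝒜 s z → PP 𝒜 k y → Commute z y := by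
      rintro s k z y ⟨hs, x, hx1, hx2, hx3⟩ hk hz hy
      obtain ⟨l, hl, hzl⟩ := hz.scalar hG (hZPP hx1 hx2 hx3)
      rw [hzl]
      exact (hy.comm_one hl).symm.mul_left (hx2.2 y (mem_DN hk hy.1))
    choose X hX using fun h : H => hPP h h.2
    let mk : H → H ⧸ S.subgroupOf H := fun h => (h : H ⧸ S.subgroupOf H)
    have hcong : ∀ (h h' : H) (x x' : D), mk h = mk h' → PP 𝒜 h x → PP 𝒜 h' x' →
        ∃ z, x = x' * z ∧ ∀ (k : H) y, PP 𝒜 k y → Commute z y := by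
      intro h h' x x' he hx hx'
      refine ⟨x'⁻¹ * x, by rw [mul_inv_cancel_left₀ hx'.2.1], ?_⟩
      intro k y hy
      have h1 : (h')⁻¹ * h ∈ S.subgroupOf H := QuotientGroup.eq.mp he.symm
      exact hScomm (Subgroup.mem_subgroupOf.mp h1) k.2 ((hx'.inv hG).mul hG hx) hy
    choose γ hγ using fun b b' : H ⧸ S.subgroupOf H =>
      (hX b.out).pairing hG hζK hζ (hX b'.out) (hab _ b.out.2 _ b'.out.2)
    have hcen : ∀ (κ : (Subring.center D)ˣ) (a : D), Commute ((κ : Subring.center D) : D) a :=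
      fun κ a => (Subring.mem_center_iff.mp (κ : Subring.center D).2 a).symm
    have key : ∀ (h k : H) (x y : D), PP 𝒜 h x → PP 𝒜 k y →
        x * y = ((γ (mk h) (mk k) : Subring.center D) : D) * (y * x) := by
      intro h k x y hx hy
      obtain ⟨z, hz, hzc⟩ := hcong h (mk h).out x _ (Quotient.out_eq' (mk h)).symm hx (hX _)
      obtain ⟨w, hw, hwc⟩ := hcong k (mk k).out y _ (Quotient.out_eq' (mk k)).symm hy (hX _)
      have h1 := hγ (mk h) (mk k)
      have hwx := hwc h x hx
      have hzy := hzc _ _ (hX (mk k).out)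
      set x0 := X (mk h).out
      set y0 := X (mk k).out
      set κ := ((γ (mk h) (mk k) : Subring.center D) : D)
      calc x * y = (x0 * (z * y0)) * w := by rw [hw, hz]; simp only [mul_assoc]
        _ = (x0 * y0) * z * w := by rw [hzy.eq]; simp only [mul_assoc]
        _ = κ * (y0 * (x * w)) := by rw [h1, hz]; simp only [mul_assoc]
        _ = κ * (y * x) := by rw [← hwx.eq, hw]; simp only [mul_assoc]
    have huniq : ∀ (h k : H) (x y : D) (κ : (Subring.center D)ˣ), PP 𝒜 h x → PP 𝒜 k y →
        x * y = ((κ : Subring.center D) : D) * (y * x) → γ (mk h) (mk k) = κ := by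
      intro h k x y κ hx hy he
      rw [key h k x y hx hy] at he
      exact Units.ext (Subtype.ext (mul_right_cancel₀ (mul_ne_zero hy.2.1 hx.2.1) he))
    have hsurj : Function.Surjective mk := QuotientGroup.mk_surjective
    have hmk : ∀ h k, mk (h * k) = mk h * mk k := fun h k => rfl
    have hr : ∀ b b₁ b₂, γ b (b₁ * b₂) = γ b b₁ * γ b b₂ := by
      intro b b₁ b₂
      obtain ⟨h, rfl⟩ := hsurj b
      obtain ⟨k₁, rfl⟩ := hsurj b₁
      obtain ⟨k₂, rfl⟩ := hsurj b₂
      rw [← hmk]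
      refine huniq h (k₁ * k₂) (X h) (X k₁ * X k₂) _ (hX h) ((hX k₁).mul hG (hX k₂)) ?_
      have h1 := key h k₁ _ _ (hX h) (hX k₁)
      have h2 := key h k₂ _ _ (hX h) (hX k₂)
      have h3 := hcen (γ (mk h) (mk k₂)) (X k₁)
      rw [Units.val_mul, Subring.coe_mul]
      calc X h * (X k₁ * X k₂) = (X h * X k₁) * X k₂ := by rw [mul_assoc]
        _ = ((γ (mk h) (mk k₁) : Subring.center D) : D) * (X k₁ * (X h * X k₂)) := by rw [h1]; simp only [mul_assoc]
        _ = _ := by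
          rw [h2, ← mul_assoc (X k₁), ← h3.eq]; simp only [mul_assoc]
    have hl : ∀ b₁ b₂ b, γ (b₁ * b₂) b = γ b₁ b * γ b₂ b := by
      intro b₁ b₂ b
      obtain ⟨h, rfl⟩ := hsurj b
      obtain ⟨k₁, rfl⟩ := hsurj b₁
      obtain ⟨k₂, rfl⟩ := hsurj b₂
      rw [← hmk]
      refine huniq (k₁ * k₂) h (X k₁ * X k₂) (X h) _ ((hX k₁).mul hG (hX k₂)) (hX h) ?_
      have h1 := key k₁ h _ _ (hX k₁) (hX h)
      have h2 := key k₂ h _ _ (hX k₂) (hX h)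
      have h3 := hcen (γ (mk k₂) (mk h)) (X k₁)
      have h4 := hcen (γ (mk k₁) (mk h)) ((γ (mk k₂) (mk h) : Subring.center D) : D)
      rw [Units.val_mul, Subring.coe_mul]
      calc X k₁ * X k₂ * X h = X k₁ * (X k₂ * X h) := by rw [mul_assoc]
        _ = ((γ (mk k₂) (mk h) : Subring.center D) : D) * ((X k₁ * X h) * X k₂) := by
          rw [h2, ← mul_assoc (X k₁), ← h3.eq]; simp only [mul_assoc]
        _ = _ := by
          rw [h1, ← mul_assoc, ← mul_assoc, ← h4.eq]; simp only [mul_assoc]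
    let iB : CommGroup (H ⧸ S.subgroupOf H) :=
      { (inferInstance : Group (H ⧸ S.subgroupOf H)) with
        mul_comm := by
          intro a b
          obtain ⟨h, rfl⟩ := hsurj a
          obtain ⟨k, rfl⟩ := hsurj b
          exact congrArg mk (Subtype.ext (hab h h.2 k k.2).eq) }
    let c : (H ⧸ S.subgroupOf H) →* (H ⧸ S.subgroupOf H) →* (Subring.center D)ˣ :=
      MonoidHom.mk' (fun b => MonoidHom.mk' (γ b) (hr b)) (fun b₁ b₂ => by
        ext b
        exact congrArg (fun u : (Subring.center D)ˣ => ((u : Subring.center D) : D)) (hl b₁ b₂ b))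
    refine symplectic_aux (Subring.center D) _ (H ⧸ S.subgroupOf H) rfl c ?_ ?_
    · intro b
      obtain ⟨h, rfl⟩ := hsurj b
      exact huniq h h _ _ 1 (hX h) (hX h) (by simp)
    · intro b hb
      obtain ⟨h, rfl⟩ := hsurj b
      refine (QuotientGroup.eq_one_iff h).mpr (Subgroup.mem_subgroupOf.mpr ?_)
      refine ⟨h.2, X h, (hX h).1, PP_mem_Z hG h.2 (hX h) ?_, (hX h).2.1⟩
      intro k hk
      refine ⟨X ⟨k, hk⟩, hX ⟨k, hk⟩, ?_⟩
      have h1 := key h ⟨k, hk⟩ _ _ (hX h) (hX _)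
      have h2 : γ (mk h) (mk ⟨k, hk⟩) = 1 := hb (mk ⟨k, hk⟩)
      rw [h2] at h1
      simpa using h1
end

section
/- Under the standing hypotheses, the center K of D is a graded subring of D, i.e., K = ⊕_{g ∈ G} (K ∩ D_g), if and only if S is contained in the center of G. Moreover, if S is contained in the center of G, then K = ⊕_{s ∈ S} (K ∩ D_s) and each K ∩ D_s is a one-dimensional K₀-vector space. -/
variable {G : Type*} [Group G] [DecidableEq G] {D : Type*} [DivisionRing D]

open Finset in
/-- Homogeneous projections. -/
theorem aux_proj [Fintype G] (𝒜 : G → AddSubgroup D) (hG : IsFaithfulGrading 𝒜) :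
    ∃ p : G → D →+ D, (∀ g x, p g x ∈ 𝒜 g) ∧ (∀ g x, x ∈ 𝒜 g → p g x = x) ∧
      (∀ g h x, x ∈ 𝒜 g → g ≠ h → p h x = 0) ∧ ∀ x, ∑ g, p g x = x := by
  classical
  letI := hG.isInternal.chooseDecomposition
  refine ⟨fun g => (AddSubgroup.subtype (𝒜 g)).comp ((DFinsupp.evalAddMonoidHom g).comp
    (DirectSum.decomposeAddEquiv 𝒜).toAddMonoidHom), ?_, ?_, ?_, ?_⟩
  · intro g x
    exact (DirectSum.decompose 𝒜 x g).2
  · intro g x hx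
    exact DirectSum.decompose_of_mem_same 𝒜 hx
  · intro g h x hx hne
    exact DirectSum.decompose_of_mem_ne 𝒜 hx hne
  · intro x
    have h1 := DirectSum.sum_support_decompose 𝒜 x
    conv_rhs => rw [← h1]
    symm
    apply Finset.sum_subset (Finset.subset_univ _)
    intro g _ hg
    simpa using hg

/-- A trace functional. -/
theorem aux_trace {D : Type*} [DivisionRing D] [CharZero D]
    [Module.Finite ↥(Subring.center D) D] :
    ∃ t : D →+ ↥(Subring.center D), (∀ a b, t (a * b) = t (b * a)) ∧
      (∀ (c : ↥(Subring.center D)) a, t (c * a) = c * t a) ∧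
      (∀ c : ↥(Subring.center D), t c = 0 → c = 0) := by
  let T : D →ₗ[↥(Subring.center D)] ↥(Subring.center D) :=
    (LinearMap.trace ↥(Subring.center D) D) ∘ₗ (LinearMap.mul ↥(Subring.center D) D)
  have hT : ∀ a, T a = LinearMap.trace ↥(Subring.center D) D
      (LinearMap.mulLeft ↥(Subring.center D) a) := fun a => rfl
  refine ⟨T.toAddMonoidHom, ?_, ?_, ?_⟩
  · intro a b
    change T (a * b) = T (b * a)
    rw [hT, hT, LinearMap.mulLeft_mul, LinearMap.mulLeft_mul]
    exact LinearMap.trace_mul_comm _ (LinearMap.mulLeft _ a) (LinearMap.mulLeft _ b)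
  · intro c a
    exact T.map_smul c a
  · intro c hc
    have h2 : T (c : D) = 0 := hc
    have h3 : T (c • (1 : D)) = c • T 1 := T.map_smul c 1
    have h4 : c • (1 : D) = (c : D) := mul_one (c : D)
    have h5 : 0 < Module.finrank ↥(Subring.center D) D := Module.finrank_pos
    rw [h4, h2, hT, LinearMap.mulLeft_one, LinearMap.trace_id, smul_eq_mul] at h3
    have h6 := congrArg (Subtype.val) h3
    simp at h6
    rcases h6 with h6 | h6
    · exact h6
    · omega

theorem aux_eig {D : Type*} [DivisionRing D] [CharZero D] (ζ : D)
    (hζK : ζ ∈ Subring.center D) (N : ℕ) (hN : 0 < N) (hζ : orderOf ζ = N) (u y : D) (hu : u ≠ 0)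
    (huN : u ^ N * y = y * u ^ N) (hy : u * y ≠ y * u) :
    ∃ d ω : D, d ≠ 0 ∧ ω ∈ Subring.center D ∧ ω ≠ 1 ∧ u * d = ω * d * u := by
  by_contra hcon
  push Not at hcon
  apply hy
  have hz0 : ζ ≠ 0 := by
    rintro rfl
    have := pow_orderOf_eq_one (0 : D)
    rw [hζ, zero_pow hN.ne'] at this
    exact zero_ne_one this
  have hc : ∀ (k : ℕ) (a : D), ζ ^ k * a = a * ζ ^ k := fun k a =>
    ((Subring.mem_center_iff.1 (Subring.pow_mem _ hζK k)) a).symm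
  have hζN : ζ ^ N = 1 := by rw [← hζ]; exact pow_orderOf_eq_one ζ
  let f : ℕ → ℕ → D := fun j i => ζ ^ (i * j) * (u ^ i * y * (u ^ i)⁻¹)
  let d : ℕ → D := fun j => ∑ i ∈ Finset.range N, f j i
  have hstep : ∀ j i, ζ ^ j * (u * f j i * u⁻¹) = f j (i + 1) := by
    intro j i
    simp only [f]
    rw [← mul_assoc u, ← hc (i * j) u, pow_succ' u i, mul_inv_rev, add_mul, one_mul,
      add_comm, pow_add]
    simp only [mul_assoc]
  have hper : ∀ j, f j N = f j 0 := by
    intro j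
    simp only [f]
    rw [huN, mul_assoc, mul_inv_cancel₀ (pow_ne_zero _ hu), pow_mul, hζN]
    simp
  have hd : ∀ j, ζ ^ j * (u * d j * u⁻¹) = d j := by
    intro j
    simp only [d]
    rw [Finset.mul_sum, Finset.sum_mul, Finset.mul_sum]
    simp only [hstep]
    have h1 := Finset.sum_range_succ (f j) N
    rw [Finset.sum_range_succ', hper] at h1
    exact add_right_cancel h1
  have hd' : ∀ j, ζ ^ j * (u * d j) = d j * u := by
    intro j
    conv_rhs => rw [← hd j]
    simp [mul_assoc, hu]
  have hd0 : ∀ j ∈ Finset.range N, j ≠ 0 → d j = 0 := by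
    intro j hj hj0
    by_contra hne
    have hj := Finset.mem_range.1 hj
    have hζj : ζ ^ j ≠ 1 := pow_ne_one_of_lt_orderOf hj0 (hζ ▸ hj)
    refine hcon (d j) (ζ ^ j)⁻¹ hne ?_ (by simpa using hζj) ?_
    · exact Subring.mem_center_iff.2 fun a => by
        have : Commute (ζ ^ j) a := hc j a
        exact (this.inv_left₀.eq).symm
    · rw [mul_assoc, ← hd' j, inv_mul_cancel_left₀ (pow_ne_zero _ hz0)]
  have hsum : ∑ j ∈ Finset.range N, d j = N * y := by
    simp only [d]
    rw [Finset.sum_comm, Finset.sum_eq_single 0]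
    · simp [f]
    · intro i hi hi0
      have hi := Finset.mem_range.1 hi
      have hζi : ζ ^ i ≠ 1 := pow_ne_one_of_lt_orderOf hi0 (hζ ▸ hi)
      simp only [f]
      rw [← Finset.sum_mul]
      have h2 := mul_geom_sum (ζ ^ i) N
      rw [← pow_mul, mul_comm i N, pow_mul, hζN, one_pow, sub_self] at h2
      have h3 := (mul_eq_zero.1 h2).resolve_left (sub_ne_zero.2 hζi)
      simp only [pow_mul]
      rw [h3, zero_mul]
    · intro h; simp [hN.ne'] at h
  have hsum2 : ∑ j ∈ Finset.range N, d j = d 0 :=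
    Finset.sum_eq_single 0 hd0 (by intro h; simp [hN.ne'] at h)
  have h5 := hd' 0
  rw [pow_zero, one_mul, ← hsum2, hsum] at h5
  have hNc : (N : D) ≠ 0 := by exact_mod_cast hN.ne'
  apply mul_left_cancel₀ hNc
  rw [← mul_assoc, (Nat.cast_commute N u).eq, mul_assoc, h5, mul_assoc]

theorem aux_inv [Fintype G] (𝒜 : G → AddSubgroup D) (hG : IsFaithfulGrading 𝒜) {g : G} {x : D}
    (hx : x ∈ 𝒜 g) : x⁻¹ ∈ 𝒜 g⁻¹ := by
  obtain ⟨p, hp, hps, hpn, hsum⟩ := aux_proj 𝒜 hG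
  by_cases h0 : x = 0
  · subst h0; simp
  have h1 : x * p g⁻¹ x⁻¹ = 1 := by
    have h2 : p 1 (x * x⁻¹) = p 1 (∑ h, x * p h x⁻¹) := by rw [← Finset.mul_sum, hsum]
    rw [mul_inv_cancel₀ h0, hps 1 1 hG.one_mem, map_sum, Finset.sum_eq_single g⁻¹] at h2
    · rw [hps] at h2
      · exact h2.symm
      · simpa using hG.mul_mem hx (hp g⁻¹ x⁻¹)
    · intro b _ hb
      apply hpn (g * b) 1 _ (hG.mul_mem hx (hp b x⁻¹))
      intro h; exact hb (eq_inv_of_mul_eq_one_right h)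
    · simp
  rw [inv_eq_of_mul_eq_one_right h1]
  exact hp _ _

theorem aux_proj_mul [Fintype G] (𝒜 : G → AddSubgroup D) (hG : IsFaithfulGrading 𝒜)
    (p : G → D →+ D) (hp : ∀ g x, p g x ∈ 𝒜 g) (hps : ∀ g x, x ∈ 𝒜 g → p g x = x)
    (hpn : ∀ g h x, x ∈ 𝒜 g → g ≠ h → p h x = 0) (hsum : ∀ x, ∑ g, p g x = x)
    {h : G} {b : D} (hb : b ∈ 𝒜 h) (g : G) (x : D) :
    p (h * g) (b * x) = b * p g x ∧ p (g * h) (x * b) = p g x * b := by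
  constructor
  · conv_lhs => rw [← hsum x]
    rw [Finset.mul_sum, map_sum, Finset.sum_eq_single g]
    · exact hps _ _ (hG.mul_mem hb (hp _ _))
    · intro k _ hk
      exact hpn (h * k) _ _ (hG.mul_mem hb (hp _ _)) (by simpa using hk)
    · simp
  · conv_lhs => rw [← hsum x]
    rw [Finset.sum_mul, map_sum, Finset.sum_eq_single g]
    · exact hps _ _ (hG.mul_mem (hp _ _) hb)
    · intro k _ hk
      exact hpn (k * h) _ _ (hG.mul_mem (hp _ _) hb) (by simpa using hk)
    · simp

/-- elements commuting with all homogeneous elements are central. -/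
theorem aux_central [Fintype G] (𝒜 : G → AddSubgroup D) (hG : IsFaithfulGrading 𝒜) (x : D)
    (h : ∀ g, ∀ b ∈ 𝒜 g, b ≠ 0 → b * x = x * b) : x ∈ Subring.center D := by
  obtain ⟨p, hp, hps, hpn, hsum⟩ := aux_proj 𝒜 hG
  rw [Subring.mem_center_iff]
  intro y
  rw [← hsum y, Finset.sum_mul, Finset.mul_sum]
  refine Finset.sum_congr rfl fun g _ => ?_
  by_cases h0 : p g y = 0
  · simp [h0]
  · exact h g _ (hp _ _) h0

/-- If a nonzero homogeneous element of degree `g` commutes with `L`, then `g ∈ H`. -/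
theorem aux_memH [Fintype G] (𝒜 : G → AddSubgroup D) (hG : IsFaithfulGrading 𝒜) {g : G} {a : D}
    (ha : a ∈ 𝒜 g) (h0 : a ≠ 0) (hL : ∀ l ∈ Lset 𝒜, a * l = l * a) : g ∈ Hset 𝒜 := by
  intro y hy l hl
  have h1 : y * a⁻¹ ∈ 𝒜 1 := by simpa using hG.mul_mem hy (aux_inv 𝒜 hG ha)
  have h2 := hl.2 _ h1
  have h3 : y = y * a⁻¹ * a := by simp [mul_assoc, h0]
  calc y * l = y * a⁻¹ * (a * l) := by rw [← mul_assoc, ← h3]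
    _ = (y * a⁻¹ * l) * a := by simp only [hL l hl, mul_assoc]
    _ = l * y := by rw [← h2, mul_assoc, ← h3]

/-- The nonzero components of a central element lie in degrees in `S`. -/
theorem aux_comp [Fintype G] [CharZero D] (𝒜 : G → AddSubgroup D) (hG : IsFaithfulGrading 𝒜)
    [Module.Finite ↥(Subring.center D) D]
    (ζ : D) (hζK : ζ ∈ Subring.center D)
    (hζ : orderOf ζ = Monoid.exponent G)
    (H : Subgroup G) (hHcar : (H : Set G) = Hset 𝒜)
    (p : G → D →+ D) (hp : ∀ g x, p g x ∈ 𝒜 g) (hps : ∀ g x, x ∈ 𝒜 g → p g x = x)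
    (hpn : ∀ g h x, x ∈ 𝒜 g → g ≠ h → p h x = 0) (hsum : ∀ x, ∑ g, p g x = x)
    (x : D) (hx : x ∈ Subring.center D) (s : G) (hs : p s x ≠ 0) :
    s ∈ Sset 𝒜 (H : Set G) := by
  have hmul := @aux_proj_mul G _ _ D _ _ 𝒜 hG p hp hps hpn hsum
  have hconj : ∀ h, ∀ b ∈ 𝒜 h, ∀ t, b * p t x = p (h * t * h⁻¹) x * b := by
    intro h b hb t
    rw [← (hmul hb t x).1, ← (hmul hb (h * t * h⁻¹) x).2, Subring.mem_center_iff.1 hx b]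
    congr 2; group
  set u := p s x with hu
  have hus : u ∈ 𝒜 s := hp s x
  have hue : ∀ b ∈ 𝒜 1, b * u = u * b := by
    intro b hb
    have := hconj 1 b hb s
    simpa using this
  have hsH : s ∈ (H : Set G) := by
    rw [hHcar]
    exact aux_memH 𝒜 hG hus hs fun l hl => (hue l hl.1).symm
  have hpow : ∀ n : ℕ, u ^ n ∈ 𝒜 (s ^ n) := by
    intro n
    induction n with
    | zero => simpa using hG.one_mem
    | succ n ih => rw [pow_succ, pow_succ]; exact hG.mul_mem ih hus
  have huL : u ^ Monoid.exponent G ∈ Lset 𝒜 := by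
    constructor
    · have := hpow (Monoid.exponent G)
      rwa [Monoid.pow_exponent_eq_one] at this
    · intro y hy
      have : Commute u y := (hue y hy).symm
      exact (this.pow_left _).eq
  have hNpos : 0 < Monoid.exponent G := Monoid.exponent_pos.2 (Monoid.ExponentExists.of_finite)
  have key : ∀ h ∈ H, ∀ y ∈ 𝒜 h, u * y = y * u := by
    intro h hh y hy
    by_contra hne
    have hhH : h ∈ Hset 𝒜 := by rw [← hHcar]; exact hh
    obtain ⟨d, ω, hd0, hωK, hω1, hud⟩ := aux_eig ζ hζK _ hNpos hζ u y hs
      (hhH y hy _ huL).symm hne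
    obtain ⟨t, ht1, ht2, ht3⟩ := aux_trace (D := D)
    have htu : t u = 0 := by
      have h1 : u = ω * (d * (u * d⁻¹)) := by
        rw [← mul_assoc d, ← mul_assoc ω, ← mul_assoc ω, ← hud]; simp [mul_assoc, hd0]
      have h2 : t u = ⟨ω, hωK⟩ * t u := by
        conv_lhs => rw [h1]
        rw [ht2 ⟨ω, hωK⟩, ht1]
        simp [mul_assoc, hd0]
      by_contra h3
      have h4 : (⟨ω, hωK⟩ : Subring.center D) = 1 := (mul_eq_right₀ h3).1 h2.symm
      exact hω1 (congrArg Subtype.val h4)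
    have hfa : ∀ g, ∃ a ∈ 𝒜 g, a ≠ 0 := by
      intro g
      have := hG.faithful g
      rw [Ne, AddSubgroup.eq_bot_iff_forall] at this
      push Not at this
      exact this
    set z : D := ∑ g : G, p (g * s * g⁻¹) x with hz
    have htz : t z = 0 := by
      rw [hz, map_sum]
      refine Finset.sum_eq_zero fun g _ => ?_
      obtain ⟨a, ha, ha0⟩ := hfa g
      have h1 := hconj g a ha s
      have h2 : p (g * s * g⁻¹) x = (a * u) * a⁻¹ := by
        rw [hu, h1]; simp [mul_assoc, ha0]
      rw [h2, ht1, ← mul_assoc, inv_mul_cancel₀ ha0, one_mul, htu]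
    have hzK : z ∈ Subring.center D := by
      apply aux_central 𝒜 hG
      intro k b hb _
      rw [hz, Finset.mul_sum, Finset.sum_mul]
      simp only [hconj k b hb]
      refine Fintype.sum_equiv (Equiv.mulLeft k) _ _ fun g => ?_
      simp [mul_assoc]
    have hz0 : z = 0 := congrArg Subtype.val (ht3 ⟨z, hzK⟩ htz)
    have hps0 : p s z = (Finset.univ.filter fun g : G => g * s * g⁻¹ = s).card • u := by
      rw [hz, map_sum, ← Finset.sum_const, Finset.sum_filter]
      refine Finset.sum_congr rfl fun g _ => ?_
      split_ifs with h1
      · rw [h1, hps _ _ (hp s x)]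
      · exact hpn _ _ _ (hp _ _) h1
    rw [hz0, map_zero] at hps0
    have h7 := smul_eq_zero.1 hps0.symm
    rcases h7 with h7 | h7
    · rw [Finset.card_eq_zero] at h7
      have : (1 : G) ∈ (Finset.univ.filter fun g : G => g * s * g⁻¹ = s) := by simp
      rw [h7] at this
      simp at this
    · exact hs h7
  refine ⟨hsH, u, hus, ⟨?_, ?_⟩, hs⟩
  · exact AddSubgroup.mem_iSup_of_mem (⟨s, hsH⟩ : (H : Set G)) hus
  · intro y hy
    induction hy using AddSubgroup.iSup_induction' with
    | hp i y hy => exact key i i.2 y hy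
    | h1 => simp
    | hadd a b _ _ ha hb => rw [mul_add, add_mul, ha, hb]

/-- Dedekind independence. -/
theorem aux_ded {ι D : Type*} [DivisionRing D] [DecidableEq ι] (L : Set D) (h1L : (1 : D) ∈ L)
    (hLm : ∀ l ∈ L, ∀ m ∈ L, l * m ∈ L) (σ : ι → D → D)
    (hσm : ∀ i, ∀ l m, σ i (l * m) = σ i l * σ i m) (hσ1 : ∀ i, σ i 1 = 1)
    (hσc : ∀ i j, ∀ l ∈ L, ∀ m ∈ L, σ i l * σ j m = σ j m * σ i l)
    (hne : ∀ i j, i ≠ j → ∃ l ∈ L, σ i l ≠ σ j l) (T : Finset ι) :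
    ∀ f : ι → D, (∀ l ∈ L, ∑ i ∈ T, σ i l * f i = 0) → ∀ i ∈ T, f i = 0 := by
  induction T using Finset.induction_on with
  | empty => simp
  | insert j T hj ih =>
    intro f hf
    have hT : ∀ i ∈ T, f i = 0 := by
      intro i hi
      obtain ⟨m, hm, hmne⟩ := hne i j (by rintro rfl; exact hj hi)
      have := ih (fun i => (σ i m - σ j m) * f i) (by
        intro l hl
        have e1 := hf (l * m) (hLm _ hl _ hm)
        have e2 := congrArg (fun z => σ j m * z) (hf l hl)
        simp only [mul_zero] at e2
        rw [Finset.mul_sum] at e2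
        rw [Finset.sum_insert hj] at e1 e2
        have e3 : ∑ i ∈ T, σ i l * ((σ i m - σ j m) * f i)
            = ∑ i ∈ T, σ i (l * m) * f i - ∑ i ∈ T, σ j m * (σ i l * f i) := by
          rw [← Finset.sum_sub_distrib]
          refine Finset.sum_congr rfl fun k _ => ?_
          rw [hσm, ← mul_assoc (σ j m), ← hσc k j l hl m hm]
          noncomm_ring
        have e4 : σ j (l * m) * f j = σ j m * (σ j l * f j) := by
          rw [hσm, hσc j j l hl m hm, mul_assoc]
        rw [e3, eq_neg_of_add_eq_zero_right e1, eq_neg_of_add_eq_zero_right e2, e4, sub_self]) i hi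
      exact (mul_eq_zero.1 this).resolve_left (sub_ne_zero.2 hmne)
    intro i hi
    rcases Finset.mem_insert.1 hi with rfl | hi
    · have := hf 1 h1L
      rw [Finset.sum_insert hj, Finset.sum_eq_zero (s := T)] at this
      · simpa [hσ1] using this
      · intro k hk; rw [hT k hk, mul_zero]
    · exact hT i hi

/-- If the center is graded then `K ∩ D_s ≠ 0` for `s ∈ S`. -/
theorem aux_exists [Fintype G] (𝒜 : G → AddSubgroup D) (hG : IsFaithfulGrading 𝒜)
    (H : Subgroup G) (hHcar : (H : Set G) = Hset 𝒜)
    (p : G → D →+ D) (hp : ∀ g x, p g x ∈ 𝒜 g) (hps : ∀ g x, x ∈ 𝒜 g → p g x = x)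
    (hpn : ∀ g h x, x ∈ 𝒜 g → g ≠ h → p h x = 0)
    (hK : ∀ x ∈ Subring.center D, ∀ g, p g x ∈ Subring.center D)
    (s : G) (hs : s ∈ Sset 𝒜 (H : Set G)) :
    ∃ x ∈ Subring.center D, x ∈ 𝒜 s ∧ x ≠ 0 := by
  classical
  obtain ⟨hsH, v, hvs, ⟨-, hvZ⟩, hv0⟩ := hs
  have hvH : ∀ h ∈ H, ∀ y ∈ 𝒜 h, v * y = y * v := fun h hh y hy =>
    hvZ y (AddSubgroup.mem_iSup_of_mem (⟨h, hh⟩ : (H : Set G)) hy)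
  have hLH : ∀ l ∈ Lset 𝒜, ∀ h ∈ H, ∀ y ∈ 𝒜 h, l * y = y * l := by
    intro l hl h hh y hy
    have : h ∈ Hset 𝒜 := by rw [← hHcar]; exact hh
    exact (this y hy l hl).symm
  have hfa : ∀ g, ∃ a ∈ 𝒜 g, a ≠ 0 := by
    intro g
    have := hG.faithful g
    rw [Ne, AddSubgroup.eq_bot_iff_forall] at this
    push Not at this
    exact this
  choose a ha ha0 using hfa
  -- independence of conjugation on the chosen representative
  have hrep : ∀ g g' : G, g⁻¹ * g' ∈ H → ∀ b ∈ 𝒜 g, b ≠ 0 → ∀ c ∈ 𝒜 g', c ≠ 0 →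
      ∀ m : D, (∀ h ∈ H, ∀ y ∈ 𝒜 h, m * y = y * m) → b * m * b⁻¹ = c * m * c⁻¹ := by
    intro g g' hgg b hb hb0 c hc hc0 m hm
    have h1 := hm _ hgg (b⁻¹ * c) (hG.mul_mem (aux_inv 𝒜 hG hb) hc)
    rw [eq_mul_inv_iff_mul_eq₀ hc0]
    simp only [mul_assoc] at h1 ⊢
    rw [h1, mul_inv_cancel_left₀ hb0]
  let r : G ⧸ H → G := Quotient.out
  have hr : ∀ q : G ⧸ H, (r q : G ⧸ H) = q := fun q => QuotientGroup.out_eq' q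
  let σ : G ⧸ H → D → D := fun q m => a (r q) * m * (a (r q))⁻¹
  have hσm : ∀ q l m, σ q (l * m) = σ q l * σ q m := by
    intro q l m
    simp [σ, mul_assoc, ha0]
  have hσL : ∀ q, ∀ l ∈ Lset 𝒜, σ q l ∈ Lset 𝒜 := by
    intro q l hl
    have hi := aux_inv 𝒜 hG (ha (r q))
    constructor
    · simpa using hG.mul_mem (hG.mul_mem (ha (r q)) hl.1) hi
    · intro y hy
      have h1 : (a (r q))⁻¹ * y * a (r q) ∈ 𝒜 1 := by
        simpa using hG.mul_mem (hG.mul_mem hi hy) (ha (r q))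
      have h2 := hl.2 _ h1
      have h3 := congrArg (fun z => a (r q) * z * (a (r q))⁻¹) h2
      simpa [σ, mul_assoc, ha0] using h3
  -- the trace of `l v`
  have hcen : ∀ l ∈ Lset 𝒜, ∑ q : G ⧸ H, σ q (l * v) ∈ Subring.center D := by
    intro l hl
    have hm : ∀ h ∈ H, ∀ y ∈ 𝒜 h, (l * v) * y = y * (l * v) := by
      intro h hh y hy
      rw [mul_assoc, hvH h hh y hy, ← mul_assoc, hLH l hl h hh y hy, mul_assoc]
    apply aux_central 𝒜 hG
    intro k b hb hb0
    rw [Finset.mul_sum, Finset.sum_mul]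
    refine Fintype.sum_equiv (MulAction.toPerm k) _ _ fun q => ?_
    have h1 := hrep (k * r q) (r (k • q)) (by
      rw [← QuotientGroup.eq, hr]
      conv_rhs => rw [← hr q]
      rfl) (b * a (r q)) (hG.mul_mem hb (ha _)) (mul_ne_zero hb0 (ha0 _)) _ (ha _) (ha0 _) _ hm
    simp only [MulAction.toPerm_apply, σ]
    rw [← h1]
    simp [mul_assoc, hb0]
  by_contra hcon
  push Not at hcon
  let T : Finset (G ⧸ H) := Finset.univ.filter fun q => r q * s * (r q)⁻¹ = s
  have hzero : ∀ l ∈ Lset 𝒜, ∑ q ∈ T, σ q l * σ q v = 0 := by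
    intro l hl
    have h1 := hcon _ (hK _ (hcen l hl) s) (hp _ _)
    rw [map_sum] at h1
    rw [← h1, Finset.sum_filter]
    refine Finset.sum_congr rfl fun q _ => ?_
    have h2 : σ q (l * v) ∈ 𝒜 (r q * s * (r q)⁻¹) := by
      have := hG.mul_mem (hG.mul_mem (ha (r q)) (hG.mul_mem hl.1 hvs)) (aux_inv 𝒜 hG (ha (r q)))
      simpa using this
    split_ifs with h3
    · rw [h3] at h2
      rw [hps _ _ h2, hσm]
    · exact (hpn _ _ _ h2 h3).symm
  have hded := aux_ded (Lset 𝒜) ⟨hG.one_mem, by simp⟩ (fun l hl m hm => ⟨by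
      simpa using hG.mul_mem hl.1 hm.1, fun y hy => by
      rw [mul_assoc, hm.2 y hy, ← mul_assoc, hl.2 y hy, mul_assoc]⟩) σ hσm
    (fun q => by simp [σ, ha0])
    (fun i j l hl m hm => (hσL i l hl).2 _ (hσL j m hm).1)
    (by
      intro i j hij
      by_contra hall
      push Not at hall
      apply hij
      rw [← hr i, ← hr j, QuotientGroup.eq]
      change _ ∈ (H : Set G)
      rw [hHcar]
      refine aux_memH 𝒜 hG (hG.mul_mem (aux_inv 𝒜 hG (ha (r i))) (ha (r j)))
        (mul_ne_zero (inv_ne_zero (ha0 _)) (ha0 _)) fun l hl => ?_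
      have h1 := hall l hl
      simp only [σ] at h1
      rw [mul_inv_eq_iff_eq_mul₀ (ha0 _)] at h1
      have h2 := congrArg (fun z => (a (r i))⁻¹ * z * a (r j)) h1
      have h3 := congrArg (fun z => (a (r i))⁻¹ * z * ((a (r i))⁻¹ * a (r j))) h1
      simp [mul_assoc, ha0] at h3
      rw [mul_assoc, ← h3])
    T (fun q => σ q v) hzero (1 : G) (by
      simp only [T, Finset.mem_filter, Finset.mem_univ, true_and]
      have hrH : r ((1 : G) : G ⧸ H) ∈ H := by
        have := QuotientGroup.eq.1 (hr ((1 : G) : G ⧸ H))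
        simpa using this
      by_contra hne
      have h1 := hvH _ hrH _ (ha _)
      have h2 := hG.mul_mem hvs (ha (r ((1 : G) : G ⧸ H)))
      have h3 := hG.mul_mem (ha (r ((1 : G) : G ⧸ H))) hvs
      have h4 := hpn _ (s * r ((1 : G) : G ⧸ H)) _ h3
        (fun h => hne (mul_inv_eq_iff_eq_mul.2 h))
      rw [← h1, hps _ _ h2] at h4
      exact mul_ne_zero hv0 (ha0 _) h4)
  simp [σ, ha0, hv0] at hded

/-- Under the standing hypotheses, the center `K` of `D` is a graded
subring of `D` (i.e. `K = ⊕_{g ∈ G} (K ∩ D_g)`) if and only if `S` is contained in the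
center of `G`; and in that case `K = ⊕_{s ∈ S} (K ∩ D_s)` with each `K ∩ D_s` a
one-dimensional `K₀`-vector space. -/
theorem center_graded_iff_S_central
    [Finite G] [CharZero D]
    (𝒜 : G → AddSubgroup D) (hG : IsFaithfulGrading 𝒜)
    [Module.Finite ↥(Subring.center D) D]
    (ζ : D) (hζK : ζ ∈ Subring.center D) (hζe : ζ ∈ 𝒜 1)
    (hζ : orderOf ζ = Monoid.exponent G)
    (H : Subgroup G) (hHcar : (H : Set G) = Hset 𝒜) (hHn : H.Normal) :
    ((∀ x ∈ Subring.center D,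
        x ∈ ⨆ g : G, ((Subring.center D).toAddSubgroup ⊓ 𝒜 g)) ↔
      Sset 𝒜 (H : Set G) ⊆ (Subgroup.center G : Set G)) ∧
    (Sset 𝒜 (H : Set G) ⊆ (Subgroup.center G : Set G) →
      -- `K = ⊕_{s ∈ S} (K ∩ D_s)`
      (∀ x ∈ Subring.center D,
        x ∈ ⨆ s : Sset 𝒜 (H : Set G), ((Subring.center D).toAddSubgroup ⊓ 𝒜 (s : G))) ∧
      -- each `K ∩ D_s` is a one-dimensional `K₀`-vector space
      (∀ s ∈ Sset 𝒜 (H : Set G),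
        ∃ x : D, x ≠ 0 ∧ x ∈ (Subring.center D).toAddSubgroup ⊓ 𝒜 s ∧
          ∀ y ∈ (Subring.center D).toAddSubgroup ⊓ 𝒜 s,
            ∃ l : D, l ∈ Subring.center D ∧ l ∈ Lset 𝒜 ∧ y = l * x)) := by
  classical
  haveI := Fintype.ofFinite G
  obtain ⟨p, hp, hps, hpn, hsum⟩ := aux_proj 𝒜 hG
  have hmul := @aux_proj_mul G _ _ D _ _ 𝒜 hG p hp hps hpn hsum
  have hcomp := aux_comp 𝒜 hG ζ hζK hζ H hHcar p hp hps hpn hsum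
  have hgr : ∀ ι : Type _, ∀ e : ι → G,
      ∀ x ∈ ⨆ i : ι, ((Subring.center D).toAddSubgroup ⊓ 𝒜 (e i)),
        ∀ g, p g x ∈ Subring.center D := by
    intro ι e x hx
    induction hx using AddSubgroup.iSup_induction' with
    | hp i y hy =>
      intro g
      by_cases h : e i = g
      · subst h; rw [hps _ _ hy.2]; exact hy.1
      · rw [hpn _ _ _ hy.2 h]; exact Subring.zero_mem _
    | h1 => intro g; rw [map_zero]; exact Subring.zero_mem _
    | hadd a b _ _ ha hb => intro g; rw [map_add]; exact Subring.add_mem _ (ha g) (hb g)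
  have hcent : ∀ s, ∀ w ∈ Subring.center D, w ∈ 𝒜 s → w ≠ 0 → s ∈ Subgroup.center G := by
    intro s w hwK hws hw0
    rw [Subgroup.mem_center_iff]
    intro g
    obtain ⟨a, ha, ha0⟩ : ∃ a ∈ 𝒜 g, a ≠ 0 := by
      have := hG.faithful g
      rw [Ne, AddSubgroup.eq_bot_iff_forall] at this
      push Not at this
      exact this
    by_contra hne
    have h1 := hG.mul_mem ha hws
    have h2 := hG.mul_mem hws ha
    have h3 := hpn _ _ _ h1 hne
    rw [Subring.mem_center_iff.1 hwK a, hps _ _ h2] at h3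
    exact mul_ne_zero hw0 ha0 h3
  have hback : Sset 𝒜 (H : Set G) ⊆ (Subgroup.center G : Set G) →
      ∀ x ∈ Subring.center D, ∀ g, p g x ∈ Subring.center D := by
    intro hS x hx s
    by_cases h0 : p s x = 0
    · rw [h0]; exact Subring.zero_mem _
    have hsc := Subgroup.mem_center_iff.1 (hS (hcomp x hx s h0))
    apply aux_central 𝒜 hG
    intro k b hb _
    rw [← (hmul hb s x).1, ← (hmul hb s x).2, hsc k, Subring.mem_center_iff.1 hx b]
  refine ⟨⟨?_, ?_⟩, ?_⟩
  · intro hK s hs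
    obtain ⟨w, hwK, hws, hw0⟩ := aux_exists 𝒜 hG H hHcar p hp hps hpn
      (fun x hx => hgr G id x (hK x hx)) s hs
    exact hcent s w hwK hws hw0
  · intro hS x hx
    rw [← hsum x]
    exact AddSubgroup.sum_mem _ fun g _ => AddSubgroup.mem_iSup_of_mem g ⟨hback hS x hx g, hp g x⟩
  · intro hS
    refine ⟨?_, ?_⟩
    · intro x hx
      rw [← hsum x]
      refine AddSubgroup.sum_mem _ fun g _ => ?_
      by_cases h0 : p g x = 0
      · rw [h0]; exact AddSubgroup.zero_mem _
      · exact AddSubgroup.mem_iSup_of_mem (⟨g, hcomp x hx g h0⟩ : Sset 𝒜 (H : Set G))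
          ⟨hback hS x hx g, hp g x⟩
    · intro s hs
      obtain ⟨w, hwK, hws, hw0⟩ := aux_exists 𝒜 hG H hHcar p hp hps hpn (hback hS) s hs
      refine ⟨w, hw0, ⟨hwK, hws⟩, fun y hy => ?_⟩
      have hwi : w⁻¹ ∈ Subring.center D := by
        rw [Subring.mem_center_iff]
        intro b
        have : Commute b w := Subring.mem_center_iff.1 hwK b
        exact this.inv_right₀.eq
      have hl := Subring.mul_mem _ hy.1 hwi
      refine ⟨y * w⁻¹, hl, ⟨?_, fun b _ => (Subring.mem_center_iff.1 hl b).symm⟩, ?_⟩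
      · simpa using hG.mul_mem hy.2 (aux_inv 𝒜 hG hws)
      · simp [mul_assoc, hw0]
end
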